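/- arXiv:math/0011226 — 2 statements merged into one kernel-verified Lean document; each statement's English description precedes it below -/
import Mathlib

section
/- Let v : {z ∈ ℂ : Im z ≤ 0} → ℝ be a continuous, nonnegative subharmonic function on the closed lower half-plane, harmonic (subharmonic) in the interior, vanishing on ℝ, and suppose there exists a real λ > 1 with v(λz) = λ·v(z) for all z in the lower half-plane. Then there exists a constant c ≥ 0 such that v(z) = −c·Im z for all z. -/
open Set Real

/-- A function satisfies the sub-mean-value inequality on a set (circle averages):
this is the submean characterization of subharmonicity for continuous functions. -/
def SubmeanOn (v : ℂ → ℝ) (s : Set ℂ) : Prop :=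
  ∀ z ∈ s, ∀ r : ℝ, 0 < r → Metric.closedBall z r ⊆ s →
    v z ≤ (2 * π)⁻¹ * ∫ θ in (0:ℝ)..(2 * π), v (z + r * Complex.exp (θ * Complex.I))

open Filter Topology

lemma SubmeanOn.mono {v : ℂ → ℝ} {s t : Set ℂ} (h : SubmeanOn v t) (hst : s ⊆ t) :
    SubmeanOn v s :=
  fun z hz r hr hsub => h z (hst hz) r hr (hsub.trans hst)

lemma integral_circle_linear (p q r : ℝ) (z : ℂ) :
    ∫ θ in (0 : ℝ)..(2 * π), (p * (z + r * Complex.exp (θ * Complex.I)).re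
      + q * (z + r * Complex.exp (θ * Complex.I)).im) = 2 * π * (p * z.re + q * z.im) := by
  have h : ∀ θ : ℝ, p * (z + r * Complex.exp (θ * Complex.I)).re
      + q * (z + r * Complex.exp (θ * Complex.I)).im
      = (p * z.re + q * z.im) + ((p * r) * Real.cos θ + (q * r) * Real.sin θ) := by
    intro θ
    simp [Complex.exp_ofReal_mul_I_re, Complex.exp_ofReal_mul_I_im]
    ring
  simp_rw [h]
  rw [intervalIntegral.integral_add (by simp)
      ((by fun_prop : Continuous _).intervalIntegrable _ _),
    intervalIntegral.integral_add ((by fun_prop : Continuous _).intervalIntegrable _ _)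
      ((by fun_prop : Continuous _).intervalIntegrable _ _)]
  simp
  ring

/-- Strong maximum principle: a continuous submean function that lies below a real-linear function
on a connected open set and touches it there coincides with it. -/
lemma SubmeanOn.eqOn_linear {v : ℂ → ℝ} {U : Set ℂ} (hU : IsOpen U) (hconn : IsPreconnected U)
    (hcont : ContinuousOn v U) (hsub : SubmeanOn v U) (p q : ℝ)
    (hle : ∀ z ∈ U, v z ≤ p * z.re + q * z.im) {z₀ : ℂ} (hz₀ : z₀ ∈ U)
    (heq : v z₀ = p * z₀.re + q * z₀.im) :
    ∀ z ∈ U, v z = p * z.re + q * z.im := by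
  set A : Set ℂ := {z | z ∈ U ∧ v z = p * z.re + q * z.im}
  have hAopen : IsOpen A := by
    rw [Metric.isOpen_iff]
    rintro z ⟨hzU, hz⟩
    obtain ⟨R, hR, hball⟩ := Metric.isOpen_iff.1 hU z hzU
    refine ⟨R, hR, fun w hw => ⟨hball hw, ?_⟩⟩
    rcases eq_or_ne w z with rfl | hne
    · exact hz
    have hr : 0 < dist w z := dist_pos.2 hne
    set r := dist w z with hrdef
    have hcb : Metric.closedBall z r ⊆ U :=
      (Metric.closedBall_subset_ball (Metric.mem_ball.1 hw)).trans hball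
    have hcirc : ∀ θ : ℝ, z + r * Complex.exp (θ * Complex.I) ∈ U := fun θ =>
      hcb (circleMap_mem_closedBall z hr.le θ)
    have hvc : Continuous fun θ : ℝ => v (z + r * Complex.exp (θ * Complex.I)) :=
      hcont.comp_continuous (by fun_prop) hcirc
    have hmean := hsub z hzU r hr hcb
    obtain ⟨θ, hθ, hθw⟩ : ∃ θ ∈ Set.Ioc (0 : ℝ) (2 * π), circleMap z r θ = w := by
      have : w ∈ circleMap z r '' Set.Ioc 0 (2 * π) := by
        rw [image_circleMap_Ioc, abs_of_pos hr]
        exact hrdef.symm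
      exact this
    refine le_antisymm (hle w (hball hw)) (not_lt.1 fun hlt => ?_)
    have hlc : Continuous fun θ : ℝ => p * (z + r * Complex.exp (θ * Complex.I)).re
        + q * (z + r * Complex.exp (θ * Complex.I)).im := by fun_prop
    have hpos := intervalIntegral.integral_pos (a := 0) (b := 2 * π) (by positivity)
      (hlc.sub hvc).continuousOn (fun θ _ => sub_nonneg.2 (hle _ (hcirc θ)))
      ⟨θ, Set.Ioc_subset_Icc_self hθ, by
        have hw' : z + r * Complex.exp (θ * Complex.I) = w := hθw
        simp only [Pi.sub_apply, hw']
        exact sub_pos.2 hlt⟩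
    simp only [Pi.sub_apply] at hpos
    rw [intervalIntegral.integral_sub (hlc.intervalIntegrable _ _) (hvc.intervalIntegrable _ _),
      integral_circle_linear, ← hz] at hpos
    rw [inv_mul_eq_div, le_div_iff₀ (by positivity)] at hmean
    linarith
  have hsubset : U ⊆ A := by
    refine hconn.subset_of_closure_inter_subset hAopen ⟨z₀, hz₀, hz₀, heq⟩ ?_
    rintro z ⟨hzcl, hzU⟩
    refine ⟨hzU, ?_⟩
    have : (𝓝[A] z).NeBot := mem_closure_iff_nhdsWithin_neBot.1 hzcl
    have h1 : Tendsto v (𝓝[A] z) (𝓝 (v z)) := (hcont z hzU).mono (fun _ h => h.1)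
    have h2 : Tendsto (fun z : ℂ => p * z.re + q * z.im) (𝓝[A] z) (𝓝 (p * z.re + q * z.im)) :=
      (by fun_prop : Continuous fun z : ℂ => p * z.re + q * z.im).continuousWithinAt
    refine tendsto_nhds_unique (h1.congr' ?_) h2
    filter_upwards [self_mem_nhdsWithin] with x hx using hx.2
  exact fun z hz => (hsubset hz).2

lemma apply_zpow_mul {v : ℂ → ℝ} {lam : ℝ} (hlam : 1 < lam)
    (hhom : ∀ z : ℂ, z.im ≤ 0 → v ((lam : ℂ) * z) = lam * v z) (n : ℤ) {z : ℂ} (hz : z.im ≤ 0) :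
    v (((lam ^ n : ℝ) : ℂ) * z) = lam ^ n * v z := by
  have h0 : 0 < lam := by linarith
  have him : ∀ m : ℤ, (((lam ^ m : ℝ) : ℂ) * z).im ≤ 0 := fun m => by
    rw [Complex.im_ofReal_mul]
    exact mul_nonpos_of_nonneg_of_nonpos (by positivity) hz
  have hstep : ∀ m : ℤ, v (((lam ^ (m + 1) : ℝ) : ℂ) * z) = lam * v (((lam ^ m : ℝ) : ℂ) * z) := by
    intro m
    rw [← hhom _ (him m), zpow_add_one₀ h0.ne']
    push_cast
    ring_nf
  induction n with
  | zero => simp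
  | succ k ih => rw [hstep, ih, zpow_add_one₀ h0.ne']; ring
  | pred k ih =>
    have h := hstep (-(k : ℤ) - 1)
    rw [sub_add_cancel, ih] at h
    have h2 : lam ^ (-(k : ℤ) - 1) * v z = lam⁻¹ * (lam ^ (-(k : ℤ)) * v z) := by
      rw [zpow_sub_one₀ h0.ne']
      ring
    rw [h2, h, inv_mul_cancel_left₀ h0.ne']

/-- For a function homogeneous under dilation by `lam`, a bound by a positively homogeneous function
on a fundamental annulus extends to the whole closed lower half-plane. -/
lemma le_of_le_on_annulus {v N : ℂ → ℝ} {lam : ℝ} (hlam : 1 < lam)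
    (hhom : ∀ z : ℂ, z.im ≤ 0 → v ((lam : ℂ) * z) = lam * v z)
    (hN : ∀ t : ℝ, 0 < t → ∀ z : ℂ, N (t * z) = t * N z) {S : Set ℂ}
    (hS : ∀ t : ℝ, 0 < t → ∀ z ∈ S, (t : ℂ) * z ∈ S) (hS' : ∀ z ∈ S, z.im ≤ 0)
    (h : ∀ z ∈ S, 1 ≤ ‖z‖ → ‖z‖ ≤ lam → v z ≤ N z) :
    ∀ z ∈ S, z ≠ 0 → v z ≤ N z := by
  intro z hz hz0
  have h0 : 0 < lam := by linarith
  obtain ⟨n, hn1, hn2⟩ := exists_mem_Ico_zpow (norm_pos_iff.2 hz0) hlam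
  have hpos : 0 < lam ^ (-n) := by positivity
  have hnorm : ‖((lam ^ (-n) : ℝ) : ℂ) * z‖ = ‖z‖ / lam ^ n := by
    rw [norm_mul, Complex.norm_real, Real.norm_of_nonneg hpos.le, zpow_neg, inv_mul_eq_div]
  have key := h _ (hS _ hpos z hz)
    (by rw [hnorm, le_div_iff₀ (by positivity)]; linarith)
    (by rw [hnorm, div_le_iff₀ (by positivity), mul_comm, ← zpow_add_one₀ h0.ne']; exact hn2.le)
  rw [apply_zpow_mul hlam hhom _ (hS' z hz), hN _ hpos] at key
  exact le_of_mul_le_mul_left key hpos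

/-- A function as in `stmt_2` whose restriction to the negative imaginary axis is bounded by
`c * |z|` is bounded by `c * (-Im z + ε * |Re z|)`. -/
lemma le_tilted {v : ℂ → ℝ}
    (hcont : ContinuousOn v {z : ℂ | z.im ≤ 0})
    (hsub : SubmeanOn v {z : ℂ | z.im < 0})
    (hzero : ∀ x : ℝ, v (x : ℂ) = 0)
    {lam : ℝ} (hlam : 1 < lam)
    (hhom : ∀ z : ℂ, z.im ≤ 0 → v ((lam : ℂ) * z) = lam * v z)
    {c : ℝ} (hc : 0 ≤ c) (haxis : ∀ z : ℂ, z.re = 0 → z.im < 0 → v z ≤ c * -z.im)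
    {ε : ℝ} (hε : 0 < ε) {z : ℂ} (hz : z.im < 0) :
    v z ≤ c * (-z.im + ε * |z.re|) := by
  set N : ℂ → ℝ := fun z => -z.im + ε * |z.re| with hNdef
  have hNc : Continuous N := by fun_prop
  have hNhom : ∀ t : ℝ, 0 < t → ∀ z : ℂ, N (t * z) = t * N z := by
    intro t ht z
    simp only [hNdef, Complex.im_ofReal_mul, Complex.re_ofReal_mul, abs_mul, abs_of_pos ht]
    ring
  have hHhom : ∀ t : ℝ, 0 < t → ∀ z ∈ {z : ℂ | z.im ≤ 0}, (t : ℂ) * z ∈ {z : ℂ | z.im ≤ 0} := by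
    intro t ht z hz
    simp only [Set.mem_ofPred_eq, Complex.im_ofReal_mul] at hz ⊢
    exact mul_nonpos_of_nonneg_of_nonpos ht.le hz
  have hNpos : ∀ z : ℂ, z.im ≤ 0 → z ≠ 0 → 0 < N z := by
    intro z hz hz0
    simp only [hNdef]
    rcases hz.lt_or_eq with h | h
    · have : 0 ≤ ε * |z.re| := by positivity
      linarith
    · have hre : z.re ≠ 0 := fun hre => hz0 (Complex.ext hre h)
      have : 0 < ε * |z.re| := by positivity
      linarith
  set K : Set ℂ := ({z : ℂ | z.im ≤ 0} ∩ {z : ℂ | 1 ≤ ‖z‖}) ∩ Metric.closedBall 0 lam with hK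
  have hKne0 : ∀ z ∈ K, z ≠ 0 := by
    rintro z ⟨⟨-, h1⟩, -⟩ rfl
    simp only [Set.mem_ofPred_eq, norm_zero] at h1
    linarith
  have hKcomp : IsCompact K :=
    (isCompact_closedBall _ _).inter_left
      ((isClosed_le Complex.continuous_im continuous_const).inter
        (isClosed_le continuous_const continuous_norm))
  have hKne : K.Nonempty := ⟨1, by simp [hK, hlam.le]⟩
  obtain ⟨z₀, hz₀, hmax⟩ := hKcomp.exists_isMaxOn hKne
    ((hcont.mono fun z hz => hz.1.1).div hNc.continuousOn
      fun z hz => (hNpos z hz.1.1 (hKne0 z hz)).ne')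
  set M := v z₀ / N z₀ with hM
  have hz₀im : z₀.im ≤ 0 := hz₀.1.1
  have hN₀ : 0 < N z₀ := hNpos z₀ hz₀im (hKne0 z₀ hz₀)
  have hvM : ∀ z : ℂ, z.im ≤ 0 → z ≠ 0 → v z ≤ M * N z := by
    refine le_of_le_on_annulus (N := fun z => M * N z) hlam hhom
      (fun t ht z => by simp only [hNhom t ht]; ring) hHhom (fun z hz => hz) ?_
    intro z hz h1 h2
    have hzK : z ∈ K := ⟨⟨hz, h1⟩, by simpa using h2⟩
    exact (div_le_iff₀ (hNpos z hz (hKne0 z hzK))).1 (hmax hzK)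
  suffices hMc : M ≤ c from
    (hvM z hz.le (by rintro rfl; simp at hz)).trans
      (mul_le_mul_of_nonneg_right hMc (hNpos z hz.le (by rintro rfl; simp at hz)).le)
  by_contra! hcM
  have hMpos : 0 < M := hc.trans_lt hcM
  have hv₀ : v z₀ = M * N z₀ := by rw [hM]; field_simp
  have him : z₀.im < 0 := by
    refine hz₀im.lt_of_ne fun h => ?_
    have : v z₀ = 0 := by
      rw [← hzero z₀.re]
      congr 1
      exact Complex.ext (by simp) (by simp [h])
    have := mul_pos hMpos hN₀
    linarith
  have hre : z₀.re ≠ 0 := by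
    intro h
    have h1 := haxis z₀ h him
    have h2 : N z₀ = -z₀.im := by simp [hNdef, h]
    rw [← h2, hv₀] at h1
    exact absurd (le_of_mul_le_mul_right h1 hN₀) (not_le.2 hcM)
  obtain ⟨σ, hσ1, hσ⟩ : ∃ σ : ℝ, |σ| = 1 ∧ 0 < σ * z₀.re := by
    rcases hre.lt_or_gt with h | h
    · exact ⟨-1, by simp, by linarith⟩
    · exact ⟨1, by simp, by linarith⟩
  set Q : Set ℂ := {z | z.im < 0} ∩ {z | 0 < σ * z.re}
  have hQopen : IsOpen Q := (isOpen_lt (by fun_prop) (by fun_prop)).inter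
    (isOpen_lt (by fun_prop) (by fun_prop))
  have hQconv : Convex ℝ Q := by
    intro x hx y hy a b ha hb hab
    obtain ⟨hx1, hx2⟩ := hx
    obtain ⟨hy1, hy2⟩ := hy
    simp only [Set.mem_ofPred_eq] at hx1 hx2 hy1 hy2
    refine ⟨?_, ?_⟩
    · simp only [Set.mem_ofPred_eq, Complex.add_im, Complex.real_smul, Complex.im_ofReal_mul]
      rcases ha.eq_or_lt with rfl | ha
      · have : b = 1 := by linarith
        simpa [this] using hy1
      · nlinarith [mul_pos ha (neg_pos.2 hx1), mul_nonneg hb (neg_pos.2 hy1).le]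
    · simp only [Set.mem_ofPred_eq, Complex.add_re, Complex.real_smul, Complex.re_ofReal_mul]
      rcases ha.eq_or_lt with rfl | ha
      · have : b = 1 := by linarith
        simpa [this] using hy2
      · nlinarith [mul_pos ha hx2, mul_nonneg hb hy2.le]
  have hσσ : σ * σ = 1 := by rw [← abs_mul_abs_self, hσ1, one_mul]
  have hNQ : ∀ z ∈ Q, M * N z = (M * ε * σ) * z.re + (-M) * z.im := by
    rintro z ⟨-, hz⟩
    have : |z.re| = σ * z.re := by
      rw [← abs_of_pos (show 0 < σ * z.re from hz), abs_mul, hσ1, one_mul]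
    simp only [hNdef, this]
    ring
  have hz₀Q : z₀ ∈ Q := ⟨him, hσ⟩
  have hEq := SubmeanOn.eqOn_linear hQopen hQconv.isPreconnected
    (hcont.mono fun z hz => (show z.im < 0 from hz.1).le) (hsub.mono fun z hz => hz.1) (M * ε * σ) (-M)
    (fun z hz => by
      rw [← hNQ z hz]
      exact hvM z (le_of_lt hz.1) (by rintro rfl; simpa using hz.1))
    hz₀Q (by rw [← hNQ z₀ hz₀Q, hv₀])
  -- Along the path `σ * t - I`, `t → 0⁺`, inside `Q`, this forces `v (-I) = M`.
  have hpath : Tendsto (fun t : ℝ => ((σ * t : ℝ) : ℂ) - Complex.I) (𝓝[>] 0)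
      (𝓝[{z : ℂ | z.im ≤ 0}] (-Complex.I)) := by
    refine tendsto_nhdsWithin_iff.2 ⟨?_, by simp⟩
    have : Continuous fun t : ℝ => ((σ * t : ℝ) : ℂ) - Complex.I := by fun_prop
    simpa using (this.tendsto 0).mono_left nhdsWithin_le_nhds
  have h1 : Tendsto (fun t : ℝ => v (((σ * t : ℝ) : ℂ) - Complex.I)) (𝓝[>] 0)
      (𝓝 (v (-Complex.I))) :=
    Tendsto.comp (g := v) (hcont (-Complex.I) (by simp)) hpath
  have h2 : Tendsto (fun t : ℝ => M * ε * t + M) (𝓝[>] 0) (𝓝 M) := by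
    have : Continuous fun t : ℝ => M * ε * t + M := by fun_prop
    simpa using (this.tendsto 0).mono_left nhdsWithin_le_nhds
  have h3 : v (-Complex.I) = M := by
    refine tendsto_nhds_unique (h1.congr' ?_) h2
    filter_upwards [self_mem_nhdsWithin] with t ht
    have ht : 0 < t := ht
    rw [hEq _ ⟨by simp, by simpa [← mul_assoc, hσσ] using ht⟩]
    simp only [Complex.sub_re, Complex.ofReal_re, Complex.I_re, Complex.sub_im, Complex.ofReal_im,
      Complex.I_im]
    linear_combination (M * ε * t) * hσσ
  have h4 := haxis (-Complex.I) (by simp) (by simp)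
  simp only [Complex.neg_im, Complex.I_im, neg_neg, mul_one] at h4
  linarith

/-- Phragmén–Lindelöf type principle on the lower half-plane: a
continuous nonnegative function, subharmonic in the open lower half-plane,
vanishing on ℝ, and homogeneous of degree 1 under dilation by some `λ > 1`,
is of the form `v z = -c * Im z`. -/
theorem stmt_2 (v : ℂ → ℝ)
    (hcont : ContinuousOn v {z : ℂ | z.im ≤ 0})
    (hpos : ∀ z : ℂ, z.im ≤ 0 → 0 ≤ v z)
    (hsub : SubmeanOn v {z : ℂ | z.im < 0})
    (hzero : ∀ x : ℝ, v (x : ℂ) = 0)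
    (lam : ℝ) (hlam : 1 < lam)
    (hhom : ∀ z : ℂ, z.im ≤ 0 → v ((lam : ℂ) * z) = lam * v z) :
    ∃ c : ℝ, 0 ≤ c ∧ ∀ z : ℂ, z.im ≤ 0 → v z = -c * z.im := by
  have hray : ContinuousOn (fun t : ℝ => v (-(t * Complex.I)) / t) (Set.Icc 1 lam) := by
    refine (hcont.comp (by fun_prop) fun t ht => ?_).div continuousOn_id fun t ht => ?_
    · simpa using zero_le_one.trans ht.1
    · exact (zero_lt_one.trans_le ht.1).ne'
  obtain ⟨t₀, ht₀, hmax⟩ := isCompact_Icc.exists_isMaxOn (Set.nonempty_Icc.2 hlam.le) hray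
  set c := v (-(t₀ * Complex.I)) / t₀ with hcdef
  have ht₀pos : 0 < t₀ := zero_lt_one.trans_le ht₀.1
  have hc : 0 ≤ c := div_nonneg (hpos _ (by simpa using ht₀pos.le)) ht₀pos.le
  have haxis : ∀ z : ℂ, z.re = 0 → z.im < 0 → v z ≤ c * -z.im := by
    intro z hz1 hz2
    refine le_of_le_on_annulus (N := fun z => c * -z.im)
      (S := {z : ℂ | z.re = 0 ∧ z.im ≤ 0}) hlam hhom ?_ ?_ (fun z hz => hz.2) ?_ z ⟨hz1, hz2.le⟩
      (by rintro rfl; simp at hz2)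
    · intro t _ z
      simp only [Complex.im_ofReal_mul]
      ring
    · rintro t ht z ⟨h1, h2⟩
      exact ⟨by simp [h1], by
        rw [Complex.im_ofReal_mul]; exact mul_nonpos_of_nonneg_of_nonpos ht.le h2⟩
    · rintro z ⟨h1, h2⟩ h3 h4
      have hzeq : z = -(((-z.im : ℝ) : ℂ) * Complex.I) := Complex.ext (by simp [h1]) (by simp)
      have hnorm : ‖z‖ = -z.im := by
        rw [hzeq, norm_neg, norm_mul, Complex.norm_I, mul_one, Complex.norm_real,
          Real.norm_of_nonneg (by linarith)]
        simp
      rw [hnorm] at h3 h4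
      have h5 : v (-(((-z.im : ℝ) : ℂ) * Complex.I)) / (-z.im) ≤ c := hmax ⟨h3, h4⟩
      rwa [← hzeq, div_le_iff₀ (by linarith)] at h5
  have hle : ∀ z ∈ {z : ℂ | z.im < 0}, v z ≤ 0 * z.re + (-c) * z.im := by
    intro z hz
    have hlim : Tendsto (fun ε : ℝ => c * (-z.im + ε * |z.re|)) (𝓝[>] 0)
        (𝓝 (0 * z.re + (-c) * z.im)) := by
      have : Continuous fun ε : ℝ => c * (-z.im + ε * |z.re|) := by fun_prop
      simpa using (this.tendsto 0).mono_left nhdsWithin_le_nhds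
    refine ge_of_tendsto hlim ?_
    filter_upwards [self_mem_nhdsWithin] with ε hε
    exact le_tilted hcont hsub hzero hlam hhom hc haxis hε hz
  have hEq := SubmeanOn.eqOn_linear (isOpen_lt Complex.continuous_im continuous_const)
    (convex_halfSpace_im_lt 0).isPreconnected (hcont.mono fun z hz => (show z.im < 0 from hz).le) hsub 0 (-c) hle
    (z₀ := -(t₀ * Complex.I)) (by simpa using ht₀pos) (by simp [hcdef, ht₀pos.ne'])
  refine ⟨c, hc, fun z hz => ?_⟩
  rcases hz.lt_or_eq with h | h
  · simpa using hEq z h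
  · have : z = (z.re : ℂ) := Complex.ext (by simp) (by simp [h])
    rw [h, mul_zero, this, hzero]
end

section
/- Let J be a compact subset of ℂᵏ that is completely invariant under a holomorphic endomorphism f of ℂᵏ admitting a repelling fixed point a ∈ J with Poincaré map φ : ℂᵏ → ℂᵏ (open holomorphic, φ(0) = a, f ∘ φ = φ ∘ Λ for a dilating automorphism Λ). If J contains a positive-dimensional complex submanifold Σ through a, then J contains a nonconstant holomorphic image of ℂ, contradicting compactness of J ⊂ ℂᵏ by Liouville's theorem. Hence J contains no complex submanifold through a repelling periodic point. -/
open Filter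

open Metric Set Topology

theorem exists_isPreconnected_lift {X Y : Type*} [TopologicalSpace X] [T2Space X]
    [TopologicalSpace Y] [T2Space Y] {φ : X → Y} (hφ : Continuous φ) (hφo : IsOpenMap φ)
    {B : Set X} (hB : IsCompact B) {C : Set Y} (hCc : IsClosed C) (hC : IsPreconnected C)
    (hBC : ∀ x ∈ B, φ x ∈ C → x ∈ interior B) {x₀ : X} (hx₀ : x₀ ∈ B) (hφx₀ : φ x₀ ∈ C)
    {c : Y} (hc : c ∈ C) :
    ∃ S ⊆ B, IsPreconnected S ∧ x₀ ∈ S ∧ φ '' S ⊆ C ∧ ∃ x ∈ S, φ x = c := by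
  set K : Set X := B ∩ φ ⁻¹' C with hK
  have hKc : IsCompact K := hB.inter_right (hCc.preimage hφ)
  have : CompactSpace K := isCompact_iff_compactSpace.1 hKc
  let k₀ : K := ⟨x₀, hx₀, hφx₀⟩
  refine ⟨Subtype.val '' connectedComponent k₀, ?_, ?_, ?_, ?_, ?_⟩
  · rintro _ ⟨y, -, rfl⟩; exact y.2.1
  · exact isPreconnected_connectedComponent.image _ continuous_subtype_val.continuousOn
  · exact ⟨k₀, mem_connectedComponent, rfl⟩
  · rintro _ ⟨_, ⟨y, -, rfl⟩, rfl⟩; exact y.2.2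
  have key : ∀ U : Set K, IsClopen U → k₀ ∈ U → ∃ x ∈ U, φ x = c := by
    intro U hU hkU
    set D : Set Y := (fun x : K => φ x) '' U with hD
    have hDcl : IsClosed D :=
      (hU.1.isCompact.image (hφ.comp continuous_subtype_val)).isClosed
    obtain ⟨G, hG, hGU⟩ := isOpen_induced_iff.1 hU.2
    set D' : Set Y := φ '' (G ∩ interior B)
    have hD'o : IsOpen D' := hφo _ (hG.inter isOpen_interior)
    have hDD' : ∀ y ∈ C, y ∈ D ↔ y ∈ D' := by
      intro y hy
      constructor
      · rintro ⟨x, hx, rfl⟩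
        refine ⟨x, ⟨?_, hBC x x.2.1 x.2.2⟩, rfl⟩
        rw [← hGU] at hx; exact hx
      · rintro ⟨x, ⟨hxG, hxB⟩, rfl⟩
        refine ⟨⟨x, interior_subset hxB, hy⟩, ?_, rfl⟩
        rw [← hGU]; exact hxG
    by_contra! hcon
    have hcD : c ∉ D := by
      rintro ⟨x, hx, hxc⟩; exact hcon x hx hxc
    obtain ⟨y, hyC, hyD', hyD⟩ := hC D' Dᶜ hD'o hDcl.isOpen_compl
      (fun y hy => (em (y ∈ D)).imp (hDD' y hy).1 id)
      ⟨φ x₀, hφx₀, (hDD' _ hφx₀).1 ⟨k₀, hkU, rfl⟩⟩ ⟨c, hc, hcD⟩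
    exact hyD ((hDD' y hyC).2 hyD')
  have hne : (⋂ s : { s : Set K // IsClopen s ∧ k₀ ∈ s },
      (s : Set K) ∩ {x : K | φ x = c}).Nonempty := by
    have hcl : IsClosed {x : K | φ x = c} :=
      isClosed_singleton.preimage (hφ.comp continuous_subtype_val)
    have : Nonempty { s : Set K // IsClopen s ∧ k₀ ∈ s } := ⟨⟨univ, isClopen_univ, mem_univ _⟩⟩
    refine IsCompact.nonempty_iInter_of_directed_nonempty_isCompact_isClosed _ ?_ ?_ ?_ ?_
    · rintro ⟨s, hs, hs'⟩ ⟨t, ht, ht'⟩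
      exact ⟨⟨s ∩ t, hs.inter ht, hs', ht'⟩, fun x hx => ⟨hx.1.1, hx.2⟩,
        fun x hx => ⟨hx.1.2, hx.2⟩⟩
    · rintro ⟨s, hs, hs'⟩
      obtain ⟨x, hx, hxc⟩ := key s hs hs'
      exact ⟨x, hx, hxc⟩
    · rintro ⟨s, hs, hs'⟩
      exact (hs.1.inter hcl).isCompact
    · rintro ⟨s, hs, hs'⟩
      exact hs.1.inter hcl
  obtain ⟨x, hx⟩ := hne
  rw [mem_iInter] at hx
  refine ⟨x, ⟨x, ?_, rfl⟩, (hx ⟨univ, isClopen_univ, mem_univ _⟩).2⟩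
  rw [connectedComponent_eq_iInter_isClopen]
  exact mem_iInter.2 fun s => (hx s).1

theorem IsPreconnected.subset_closedBall_of_disjoint_sphere {E : Type*}
    [SeminormedAddCommGroup E] {S : Set E} (hS : IsPreconnected S) (h0 : (0 : E) ∈ S) {ε : ℝ}
    (hε : 0 < ε) (h : ∀ x ∈ S, ‖x‖ ≠ ε) : S ⊆ closedBall 0 ε := by
  intro x hx
  by_contra hxε
  rw [mem_closedBall_zero_iff, not_le] at hxε
  obtain ⟨y, hy, hye⟩ := hS.intermediate_value h0 hx continuous_norm.continuousOn
    (show ε ∈ Icc ‖(0 : E)‖ ‖x‖ from ⟨by simpa using hε.le, hxε.le⟩)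
  exact h y hy hye

/-- No compact set supports a forward orbit staying away from `x₀` for a map whose inverse iterates
tend pointwise to `x₀`. -/
theorem false_of_orbit_mem_compact {X : Type*} [TopologicalSpace X] [T2Space X]
    {Λ Λinv : X → X} (hΛ : Continuous Λ) (hinv : Function.LeftInverse Λinv Λ) {x₀ : X}
    (hdil : ∀ z, Tendsto (fun m => Λinv^[m] z) atTop (𝓝 x₀))
    {B F : Set X} (hB : IsCompact B) (hF : IsClosed F) (hx₀ : x₀ ∉ F) {z : X}
    (hzB : ∀ j, Λ^[j] z ∈ B) (hzF : ∀ j, Λ^[j] z ∈ F) : False := by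
  have hlim : ∀ i : ℕ, ∃ y ∈ B, Tendsto (fun j => Λ^[j - i] z) (hyperfilter ℕ) (𝓝 y) := by
    intro i
    have := hB.ultrafilter_le_nhds ((hyperfilter ℕ).map fun j => Λ^[j - i] z)
      (tendsto_principal.2 (Eventually.of_forall fun j => hzB _))
    simpa [Tendsto] using this
  choose y hyB hy using hlim
  have hstep : ∀ i, y (i + 1) = Λinv (y i) := by
    intro i
    have h1 : Tendsto (fun j => Λ^[j - i] z) (hyperfilter ℕ) (𝓝 (Λ (y (i + 1)))) := by
      refine ((hΛ.tendsto _).comp (hy (i + 1))).congr' ?_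
      have : ∀ᶠ j in (hyperfilter ℕ : Filter ℕ), i + 1 ≤ j := by
        have := hyperfilter_le_cofinite (α := ℕ)
        rw [Nat.cofinite_eq_atTop] at this
        exact this (eventually_ge_atTop _)
      filter_upwards [this] with j hj
      simp only [Function.comp]
      rw [← Function.iterate_succ_apply' Λ]
      congr 1; omega
    rw [tendsto_nhds_unique (hy i) h1, hinv]
  have hiter : ∀ i, y i = Λinv^[i] (y 0) := by
    intro i
    induction i with
    | zero => rfl
    | succ i ih => rw [hstep, ih, Function.iterate_succ_apply']
  have hyF : ∀ i, y i ∈ F := fun i => hF.mem_of_tendsto (hy i) (Eventually.of_forall fun j => hzF _)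
  have : x₀ ∈ F := hF.mem_of_tendsto (hdil (y 0))
    (Eventually.of_forall fun i => by rw [← hiter]; exact hyF i)
  exact hx₀ this

theorem norm_sub_sub_smul_deriv_le {E : Type*} [NormedAddCommGroup E] [NormedSpace ℂ E]
    [CompleteSpace E] {h : ℂ → E} (hd : DifferentiableOn ℂ h (ball 0 1)) {R : ℝ}
    (hR : ∀ t ∈ ball (0 : ℂ) 1, ‖h t - h 0‖ ≤ R) {t : ℂ} (ht : t ∈ ball (0 : ℂ) 1) :
    ‖h t - h 0 - t • deriv h 0‖ ≤ 2 * R * ‖t‖ ^ 2 := by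
  have hb : ball (0 : ℂ) 1 ∈ 𝓝 (0 : ℂ) := ball_mem_nhds _ one_pos
  have hg : DifferentiableOn ℂ (dslope h 0) (ball 0 1) := (Complex.differentiableOn_dslope hb).2 hd
  have hm : MapsTo h (ball 0 1) (closedBall (h 0) R) := fun t ht => by
    simpa [dist_eq_norm] using hR t ht
  have hgR : ∀ t ∈ ball (0 : ℂ) 1, ‖dslope h 0 t‖ ≤ R := fun t ht => by
    simpa using Complex.norm_dslope_le_div_of_mapsTo_ball hd hm ht
  have hgm : MapsTo (dslope h 0) (ball 0 1) (closedBall (dslope h 0 0) (2 * R)) := fun t ht => by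
    rw [mem_closedBall, dist_eq_norm]
    calc _ ≤ ‖dslope h 0 t‖ + ‖dslope h 0 0‖ := norm_sub_le _ _
      _ ≤ R + R := add_le_add (hgR t ht) (hgR 0 (mem_of_mem_nhds hb))
      _ = _ := by ring
  have h2 := Complex.dist_le_div_mul_dist_of_mapsTo_ball hg hgm ht
  rw [dist_eq_norm, dslope_same, div_one, dist_zero_right] at h2
  have h3 : h t - h 0 - t • deriv h 0 = t • (dslope h 0 t - deriv h 0) := by
    have := sub_smul_dslope h 0 t
    rw [sub_zero] at this
    rw [smul_sub, this]
  rw [h3, norm_smul]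
  nlinarith [norm_nonneg t]

theorem exists_le_norm_pow_apply {E : Type*} [NormedAddCommGroup E] [NormedSpace ℂ E]
    [FiniteDimensional ℂ E] (A : E →L[ℂ] E)
    (hA : ∀ x, Tendsto (fun m => (A ^ m) x) atTop (𝓝 0) → x = 0) {v : E} (hv : v ≠ 0) {M : ℝ}
    (hM : ∀ m, ‖(A ^ m) v‖ ≤ M) : ∃ c > 0, ∀ m, c ≤ ‖(A ^ m) v‖ := by
  let W : Submodule ℂ E :=
    { carrier := {x | ∃ C, ∀ m, ‖(A ^ m) x‖ ≤ C}
      zero_mem' := ⟨0, by simp⟩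
      add_mem' := by
        rintro x y ⟨C, hC⟩ ⟨D, hD⟩
        exact ⟨C + D, fun m => by
          rw [map_add]; exact (norm_add_le _ _).trans (add_le_add (hC m) (hD m))⟩
      smul_mem' := by
        rintro c x ⟨C, hC⟩
        exact ⟨‖c‖ * C, fun m => by
          rw [map_smul, norm_smul]; exact mul_le_mul_of_nonneg_left (hC m) (norm_nonneg _)⟩ }
  obtain ⟨C, hC⟩ := banach_steinhaus (g := fun n => (A ^ n).comp W.subtypeL) (fun x => x.2)
  have hCv : ∀ m n, ‖(A ^ (n + m)) v‖ ≤ C * ‖(A ^ m) v‖ := by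
    intro m n
    have hmem : (A ^ m) v ∈ W := ⟨M, fun j => by
      have := hM (j + m); rwa [pow_add] at this⟩
    have := ((A ^ n).comp W.subtypeL).le_of_opNorm_le (hC n) ⟨_, hmem⟩
    simpa [pow_add] using this
  by_contra! hcon
  refine hv (hA v ?_)
  have hC0 : 0 ≤ C := (norm_nonneg _).trans (hC 0)
  rw [Metric.tendsto_atTop]
  intro ε hε
  obtain ⟨m, hm⟩ := hcon (ε / (C + 1)) (by positivity)
  refine ⟨m, fun n hn => ?_⟩
  rw [dist_zero_right]
  obtain ⟨j, rfl⟩ := Nat.exists_eq_add_of_le' hn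
  calc _ ≤ C * ‖(A ^ m) v‖ := hCv m j
    _ ≤ C * (ε / (C + 1)) := by gcongr
    _ < ε := by rw [mul_div_assoc', div_lt_iff₀ (by positivity)]; nlinarith

section Spectral

variable {E : Type*} [NormedAddCommGroup E] [NormedSpace ℂ E] [FiniteDimensional ℂ E]

theorem ContinuousLinearMap.isUnit_of_injective {T : E →L[ℂ] E} (h : Function.Injective T) :
    IsUnit T := by
  have : CompleteSpace E := FiniteDimensional.complete ℂ E
  rw [ContinuousLinearMap.isUnit_iff_bijective]
  exact ⟨h, LinearMap.surjective_of_injective (f := (T : E →ₗ[ℂ] E)) h⟩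

theorem ContinuousLinearMap.exists_eigenvector_of_mem_spectrum {T : E →L[ℂ] E} {ν : ℂ}
    (h : ν ∈ spectrum ℂ T) : ∃ x ≠ 0, T x = ν • x := by
  by_contra! hcon
  refine h (ContinuousLinearMap.isUnit_of_injective ?_)
  rw [injective_iff_map_eq_zero]
  intro x hx
  by_contra hx0
  refine hcon x hx0 ?_
  rw [sub_apply, sub_eq_zero, Algebra.algebraMap_eq_smul_one] at hx
  exact hx.symm

omit [FiniteDimensional ℂ E] in
theorem ContinuousLinearMap.aeval_apply_of_eigenvector {T : E →L[ℂ] E} {ν : ℂ} {x : E}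
    (h : T x = ν • x) (q : Polynomial ℂ) : Polynomial.aeval T q x = q.eval ν • x := by
  induction q using Polynomial.induction_on' with
  | add p q hp hq => simp [hp, hq, add_smul]
  | monomial n c =>
    have : (T ^ n) x = ν ^ n • x := by
      induction n with
      | zero => simp
      | succ n ih => 
        have : (T ^ (n + 1)) x = (T ^ n) (T x) := by rw [pow_succ]; rfl
        rw [this, h, map_smul, ih, smul_smul, pow_succ, mul_comm]
    simp [Polynomial.aeval_monomial, this, Algebra.algebraMap_eq_smul_one, smul_smul]

theorem ContinuousLinearMap.tendsto_pow_of_spectralRadius_lt {T : E →L[ℂ] E} {r : NNReal}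
    (h : spectralRadius ℂ T < r) {c : ℝ} (hc : 0 < c) :
    ∀ᶠ n in atTop, ‖T ^ n‖ ≤ c * (r : ℝ) ^ n := by
  have : CompleteSpace E := FiniteDimensional.complete ℂ E
  obtain ⟨s, hs, hsr⟩ := ENNReal.lt_iff_exists_nnreal_btwn.1 h
  have hsr' : (s : ℝ) < r := by exact_mod_cast hsr
  have h1 := (spectrum.pow_nnnorm_pow_one_div_tendsto_nhds_spectralRadius T).eventually_lt_const hs
  have h2 : Tendsto (fun n : ℕ => ((s : ℝ) / r) ^ n) atTop (𝓝 0) :=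
    tendsto_pow_atTop_nhds_zero_of_lt_one (by positivity)
      ((div_lt_one (s.2.trans_lt hsr')).2 hsr')
  filter_upwards [h1, h2.eventually_lt_const hc, eventually_gt_atTop 0] with n hn hn2 hn0
  have hr0 : (0 : ℝ) < (r : ℝ) ^ n := pow_pos (s.2.trans_lt hsr') n
  rw [div_pow, div_lt_iff₀ hr0] at hn2
  refine le_trans ?_ hn2.le
  rw [← ENNReal.coe_rpow_of_nonneg _ (by positivity), ENNReal.coe_lt_coe] at hn
  have h3 : ‖T ^ n‖₊ ≤ s ^ n := by
    have := pow_le_pow_left₀ (zero_le) hn.le n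
    rwa [← NNReal.rpow_mul_natCast, one_div, inv_mul_cancel₀ (by positivity),
      NNReal.rpow_one] at this
  exact_mod_cast h3

theorem ContinuousLinearMap.exists_eigenvector_of_tendsto_pow (A : E →L[ℂ] E) {x₀ : E}
    (hx₀ : x₀ ≠ 0) (hA : Tendsto (fun m => (A ^ m) x₀) atTop (𝓝 0)) :
    ∃ (ν : ℂ) (x : E), x ≠ 0 ∧ A x = ν • x ∧ ‖ν‖ < 1 := by
  let W : Submodule ℂ E :=
    { carrier := {x | Tendsto (fun m => (A ^ m) x) atTop (𝓝 0)}
      zero_mem' := by simp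
      add_mem' := fun {x y} hx hy => by
        have : Tendsto (fun m => (A ^ m) x + (A ^ m) y) atTop (𝓝 (0 + 0)) := Tendsto.add hx hy
        simpa using this
      smul_mem' := fun c x hx => by
        have : Tendsto (fun m => c • (A ^ m) x) atTop (𝓝 (c • 0)) := Tendsto.const_smul hx c
        change Tendsto (fun m => (A ^ m) (c • x)) atTop (𝓝 0)
        simpa only [map_smul, smul_zero] using this }
  have hAW : ∀ x ∈ W, (A : E →ₗ[ℂ] E) x ∈ W := fun x hx => by
    refine ((tendsto_add_atTop_iff_nat 1).2 (show Tendsto _ _ _ from hx)).congr fun m => ?_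
    rw [pow_succ]; rfl
  have : Nontrivial W := ⟨⟨x₀, hA⟩, 0, fun h => hx₀ (congrArg Subtype.val h)⟩
  obtain ⟨ν, hν⟩ := Module.End.exists_eigenvalue ((A : E →ₗ[ℂ] E).restrict hAW)
  obtain ⟨x, hx⟩ := hν.exists_hasEigenvector
  have hx0 : (x : E) ≠ 0 := fun h => hx.2 (Subtype.ext h)
  have hAx : A x = ν • (x : E) := congrArg Subtype.val hx.apply_eq_smul
  refine ⟨ν, x, hx0, hAx, ?_⟩
  have h1 : ∀ m, (A ^ m) (x : E) = ν ^ m • (x : E) := fun m => by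
    have := aeval_apply_of_eigenvector hAx (Polynomial.X ^ m)
    simpa using this
  have h2 : Tendsto (fun m : ℕ => ‖ν ^ m‖ * ‖(x : E)‖) atTop (𝓝 0) := by
    have : Tendsto (fun m => (A ^ m) (x : E)) atTop (𝓝 0) := x.2
    simpa [h1, norm_smul] using this.norm
  have h3 : Tendsto (fun m : ℕ => ‖ν ^ m‖) atTop (𝓝 0) := by
    have := h2.mul_const (‖(x : E)‖⁻¹)
    simpa [mul_assoc, mul_inv_cancel₀ (norm_ne_zero_iff.2 hx0)] using this
  rw [← tendsto_pow_atTop_nhds_zero_iff_norm_lt_one]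
  exact tendsto_zero_iff_norm_tendsto_zero.2 h3

/-- Spectral splitting along the unit circle, in a quantitative form. -/
theorem ContinuousLinearMap.exists_dominated_splitting (A : E →L[ℂ] E) {x₀ : E} (hx₀ : x₀ ≠ 0)
    (hA : Tendsto (fun m => (A ^ m) x₀) atTop (𝓝 0)) :
    ∃ (N : ℕ) (p : E →L[ℂ] E) (α : ℝ) (e : E), 0 < α ∧ α ≤ 1 ∧ A * p = p * A ∧ p * p = p ∧
      e ≠ 0 ∧ p e = e ∧ (∀ x, ‖(A ^ N) (p x)‖ ≤ α / 8 * ‖p x‖) ∧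
      ∀ x, 8 * α * ‖x - p x‖ ≤ ‖(A ^ N) (x - p x)‖ := by
  classical
  have hcomplete : CompleteSpace E := FiniteDimensional.complete ℂ E
  have hint : IsIntegral ℂ A := Algebra.IsIntegral.isIntegral A
  set χ := minpoly ℂ A
  have hχ0 : χ ≠ 0 := minpoly.ne_zero hint
  have hsplit : (χ.roots.map fun ν => Polynomial.X - Polynomial.C ν).prod = χ :=
    Polynomial.prod_multiset_X_sub_C_of_monic_of_roots_card_eq (minpoly.monic hint)
      IsAlgClosed.card_roots_eq_natDegree
  set q₁ := ((χ.roots.filter (‖·‖ < 1)).map fun ν => Polynomial.X - Polynomial.C ν).prod with hq₁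
  set q₂ := ((χ.roots.filter (¬ ‖·‖ < 1)).map fun ν => Polynomial.X - Polynomial.C ν).prod with hq₂
  have hq : q₁ * q₂ = χ := by
    rw [hq₁, hq₂, ← Multiset.prod_add, ← Multiset.map_add, Multiset.filter_add_not, hsplit]
  have hr₁ : ∀ ν, q₁.eval ν = 0 → ‖ν‖ < 1 := by
    intro ν hν
    rw [hq₁, Polynomial.eval_multiset_prod, Multiset.prod_eq_zero_iff] at hν
    simp only [Multiset.map_map, Multiset.mem_map, Multiset.mem_filter, Function.comp] at hν
    obtain ⟨b, ⟨-, hb⟩, h0⟩ := hν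
    rw [Polynomial.eval_sub, Polynomial.eval_X, Polynomial.eval_C, sub_eq_zero] at h0
    rwa [h0]
  have hr₂ : ∀ ν, q₂.eval ν = 0 → 1 ≤ ‖ν‖ := by
    intro ν hν
    rw [hq₂, Polynomial.eval_multiset_prod, Multiset.prod_eq_zero_iff] at hν
    simp only [Multiset.map_map, Multiset.mem_map, Multiset.mem_filter, Function.comp] at hν
    obtain ⟨b, ⟨-, hb⟩, h0⟩ := hν
    rw [Polynomial.eval_sub, Polynomial.eval_X, Polynomial.eval_C, sub_eq_zero] at h0
    rw [h0]; exact not_lt.1 hb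
  obtain ⟨u, w, huw⟩ : IsCoprime q₁ q₂ := by
    rw [Polynomial.isCoprime_iff_aeval_ne_zero_of_isAlgClosed ℂ ℂ]
    intro ν
    by_contra! h
    rw [Polynomial.coe_aeval_eq_eval] at h
    exact (hr₁ ν h.1).not_ge (hr₂ ν h.2)
  set p : E →L[ℂ] E := Polynomial.aeval A (w * q₂) with hp
  set q : E →L[ℂ] E := Polynomial.aeval A (u * q₁) with hqdef
  have hpq : q + p = 1 := by rw [hp, hqdef, ← map_add, huw, map_one]
  have hpA : A * p = p * A := by
    have : A = Polynomial.aeval A (Polynomial.X : Polynomial ℂ) := by simp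
    conv_lhs => rw [this, hp, ← map_mul, mul_comm, map_mul]
    simp [hp]
  have hq₁p : Polynomial.aeval A q₁ * p = 0 := by
    rw [hp, ← map_mul, mul_left_comm, hq, map_mul, minpoly.aeval, mul_zero]
  have hq₂q : Polynomial.aeval A q₂ * q = 0 := by
    rw [hqdef, ← map_mul, mul_left_comm, mul_comm q₂, hq, map_mul, minpoly.aeval, mul_zero]
  have hqp : q * p = 0 := by rw [hqdef, map_mul, mul_assoc, hq₁p, mul_zero]
  have hpp : p * p = p := by
    calc p * p = (q + p) * p := by rw [add_mul, hqp, zero_add]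
      _ = p := by rw [hpq, one_mul]
  have hqe : q = 1 - p := eq_sub_of_add_eq hpq
  have hpq0 : p * q = 0 := by rw [hqe, mul_sub, mul_one, hpp, sub_self]
  have hqq : q * q = q := by
    calc q * q = (q + p) * q := by rw [add_mul, hpq0, add_zero]
      _ = q := by rw [hpq, one_mul]
  have hqA : A * q = q * A := by rw [hqe, mul_sub, sub_mul, hpA, mul_one, one_mul]
  have heig₁ : ∀ (ν : ℂ) (x : E), x ≠ 0 → p x = x → A x = ν • x → ‖ν‖ < 1 := by
    intro ν x hx hpx hAx
    refine hr₁ ν ?_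
    have h1 : (Polynomial.aeval A q₁ * p) x = 0 := by rw [hq₁p]; rfl
    have h2 : Polynomial.aeval A q₁ (p x) = 0 := h1
    rw [hpx, aeval_apply_of_eigenvector hAx] at h2
    exact (smul_eq_zero.1 h2).resolve_right hx
  have heig₂ : ∀ (ν : ℂ) (x : E), x ≠ 0 → q x = x → A x = ν • x → 1 ≤ ‖ν‖ := by
    intro ν x hx hpx hAx
    refine hr₂ ν ?_
    have h1 : (Polynomial.aeval A q₂ * q) x = 0 := by rw [hq₂q]; rfl
    have h2 : Polynomial.aeval A q₂ (q x) = 0 := h1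
    rw [hpx, aeval_apply_of_eigenvector hAx] at h2
    exact (smul_eq_zero.1 h2).resolve_right hx
  -- the part with spectrum inside the unit disc
  have hρ : spectralRadius ℂ (A * p) < (1 : NNReal) := by
    rcases (spectrum ℂ (A * p)).eq_empty_or_nonempty with h | h
    · simp [spectralRadius, h]
    refine spectrum.spectralRadius_lt_of_forall_lt_of_nonempty h fun ν hν => ?_
    obtain ⟨x, hx, hAx⟩ := exists_eigenvector_of_mem_spectrum hν
    rcases eq_or_ne ν 0 with rfl | hν0
    · simp
    have hpx : p x = x := by
      have h1 : p ((A * p) x) = (A * p) x := by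
        have : p * (A * p) = A * p := by rw [← mul_assoc, ← hpA, mul_assoc, hpp]
        exact DFunLike.congr_fun this x
      rw [hAx, map_smul] at h1
      exact smul_right_injective _ hν0 h1
    have hAx' : A x = ν • x := by
      have h1 : A (p x) = ν • x := hAx
      rwa [hpx] at h1
    exact_mod_cast heig₁ ν x hx hpx hAx'
  -- the inverse on the complementary part
  obtain ⟨T, hT⟩ : IsUnit (A * q + p) := by
    refine isUnit_of_injective ?_
    rw [injective_iff_map_eq_zero]
    intro x hx
    by_contra hx0
    have h1 : p x = 0 := by
      have h2 : p * (A * q + p) = p := by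
        rw [mul_add, ← mul_assoc, ← hpA, mul_assoc, hpq0, mul_zero, zero_add, hpp]
      have h3 : p ((A * q + p) x) = p x := DFunLike.congr_fun h2 x
      rw [← h3, hx, map_zero]
    have h2 : q x = x := by rw [hqe]; simp [h1]
    have h3 : A (q x) + p x = 0 := hx
    rw [h1, add_zero, h2] at h3
    have := heig₂ 0 x hx0 h2 (by rw [h3, zero_smul])
    simp at this
    exact this.not_gt one_pos
  set R : E →L[ℂ] E := ↑T⁻¹ * q with hR
  have hTq : Commute (T : E →L[ℂ] E) q := by
    rw [hT]
    refine Commute.add_left (Commute.mul_left hqA (Commute.refl q)) ?_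
    exact hpq0.trans hqp.symm
  have hTq' : Commute (↑T⁻¹ : E →L[ℂ] E) q := hTq.units_inv_left
  have hRA : R * (A * q) = q := by
    have h1 : A * q = T * q := by
      rw [hT, add_mul, mul_assoc, hqq, hpq0, add_zero]
    calc R * (A * q) = ↑T⁻¹ * (q * T) * q := by rw [hR, h1]; simp only [mul_assoc]
      _ = (↑T⁻¹ * T) * (q * q) := by rw [← hTq.eq]; simp only [mul_assoc]
      _ = q := by rw [hqq, Units.inv_mul, one_mul]
  have hqAn : ∀ n, A ^ n * q = q * A ^ n := fun n => Commute.pow_left (show Commute A q from hqA) n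
  have hRAn : ∀ n, R ^ n * (A ^ n * q) = q := by
    intro n
    induction n with
    | zero => simp
    | succ n ih =>
      calc R ^ (n + 1) * (A ^ (n + 1) * q) = R ^ n * (R * (A * (A ^ n * q))) := by
            rw [pow_succ, pow_succ']; simp only [mul_assoc]
        _ = R ^ n * (R * (A * q) * (A ^ n * q)) := by
            rw [hqAn]; simp only [mul_assoc]; rw [← mul_assoc q q, hqq]
        _ = q := by rw [hRA, ← mul_assoc q, ← hqAn, mul_assoc, hqq, ih]
  have hRρ : spectralRadius ℂ R ≤ 1 := by
    refine iSup₂_le fun ν hν => ?_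
    obtain ⟨x, hx, hRx⟩ := exists_eigenvector_of_mem_spectrum hν
    rcases eq_or_ne ν 0 with rfl | hν0
    · simp
    have hqR : q * R = R := by rw [hR, hTq'.eq, ← mul_assoc, hqq]
    have hqx : q x = x := by
      have h1 : q (R x) = R x := DFunLike.congr_fun hqR x
      rw [hRx, map_smul] at h1
      exact smul_right_injective _ hν0 h1
    have hpx : p x = 0 := by
      rw [← hqx]; exact DFunLike.congr_fun hpq0 x
    have hTR : (T : E →L[ℂ] E) * R = q := by rw [hR, ← mul_assoc, Units.mul_inv, one_mul]
    have h1 : ν • A x = x := by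
      have h2 : (T : E →L[ℂ] E) (R x) = q x := DFunLike.congr_fun hTR x
      have h3 : (T : E →L[ℂ] E) x = A x := by
        rw [hT]
        have : A (q x) + p x = A x := by rw [hqx, hpx, add_zero]
        exact this
      rwa [hRx, map_smul, h3, hqx] at h2
    have h2 : A x = ν⁻¹ • x := by
      conv_rhs => rw [← h1]
      rw [smul_smul, inv_mul_cancel₀ hν0, one_smul]
    have h3 := heig₂ _ x hx hqx h2
    rw [norm_inv] at h3
    have h4 : ‖ν‖ ≤ 1 := by
      by_contra! h
      exact (inv_lt_one_of_one_lt₀ h).not_ge h3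
    exact_mod_cast h4
  obtain ⟨ν, e, he, hAe, hν⟩ := exists_eigenvector_of_tendsto_pow A hx₀ hA
  have hpe : p e = e := by
    have h1 : Polynomial.aeval A χ e = 0 := by rw [minpoly.aeval]; rfl
    rw [aeval_apply_of_eigenvector hAe, smul_eq_zero, or_iff_left he, ← hq, Polynomial.eval_mul,
      mul_eq_zero, or_iff_left fun h => (hr₂ ν h).not_gt hν] at h1
    have h2 : q e = 0 := by
      rw [hqdef, aeval_apply_of_eigenvector hAe, Polynomial.eval_mul, h1, mul_zero, zero_smul]
    have h3 : q e + p e = e := DFunLike.congr_fun hpq e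
    rwa [h2, zero_add] at h3
  obtain ⟨μ, hμ, hμ1⟩ := ENNReal.lt_iff_exists_nnreal_btwn.1 hρ
  have hμ0 : 0 < μ := by
    have := (zero_le).trans_lt hμ
    exact_mod_cast this
  have hμ1' : μ < 1 := by exact_mod_cast hμ1
  have hRμ : spectralRadius ℂ R < (μ⁻¹ : NNReal) := by
    refine hRρ.trans_lt ?_
    have := (one_lt_inv₀ hμ0).2 hμ1'
    exact_mod_cast this
  obtain ⟨N, ⟨hN1, hN2⟩, hN0⟩ :=
    (((tendsto_pow_of_spectralRadius_lt hμ (c := 1 / 8) (by norm_num)).and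
    (tendsto_pow_of_spectralRadius_lt hRμ (c := 1 / 8) (by norm_num))).and
    (eventually_gt_atTop 0)).exists
  have hμN : (0 : ℝ) < (μ : ℝ) ^ N := by positivity
  refine ⟨N, p, (μ : ℝ) ^ N, e, hμN, pow_le_one₀ μ.2 hμ1'.le, hpA, hpp, he, hpe, fun x => ?_,
    fun x => ?_⟩
  · have h1 : (A * p) ^ N * p = A ^ N * p := by
      rw [Commute.mul_pow hpA, IsIdempotentElem.pow_eq hpp hN0.ne', mul_assoc, hpp]
    have h2 : ((A * p) ^ N) (p x) = (A ^ N) (p x) := DFunLike.congr_fun h1 x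
    rw [← h2]
    refine (le_of_opNorm_le _ hN1 _).trans_eq (by ring)
  · have h1 : x - p x = q x := by rw [hqe]; rfl
    have h2 : (R ^ N) ((A ^ N) (q x)) = q x := DFunLike.congr_fun (hRAn N) x
    rw [h1]
    have h3 := le_of_opNorm_le (R ^ N) hN2 ((A ^ N) (q x))
    rw [h2, NNReal.coe_inv, inv_pow] at h3
    have h4 := mul_le_mul_of_nonneg_left h3 (show 0 ≤ 8 * (μ : ℝ) ^ N by positivity)
    refine h4.trans_eq ?_
    field_simp

end Spectral

theorem map_zero_of_tendsto {X : Type*} [TopologicalSpace X] [T2Space X] {Λ Λinv : X → X}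
    (hΛ : Continuous Λ) (hinv : Function.RightInverse Λinv Λ) {x₀ : X}
    (hdil : Tendsto (fun m => Λinv^[m] x₀) atTop (𝓝 x₀)) : Λ x₀ = x₀ := by
  refine tendsto_nhds_unique ((hΛ.tendsto x₀).comp ((tendsto_add_atTop_iff_nat 1).2 hdil)) ?_
  refine hdil.congr fun m => ?_
  simp only [Function.comp, Function.iterate_succ_apply', hinv _]

theorem exists_isOpen_forall_iterate_mem {X : Type*} [TopologicalSpace X] [T2Space X] [BaireSpace X]
    [Nonempty X] {Λ Λinv : X → X} (hΛ : Continuous Λ) (hl : Function.LeftInverse Λinv Λ)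
    (hr : Function.RightInverse Λinv Λ) {x₀ : X}
    (hdil : ∀ z, Tendsto (fun m => Λinv^[m] z) atTop (𝓝 x₀)) {B : Set X} (hB : IsCompact B)
    (hBx : B ∈ 𝓝 x₀) :
    ∃ O : Set X, IsOpen O ∧ O.Nonempty ∧ ∀ z ∈ O, ∀ m, Λinv^[m] z ∈ B := by
  have hlm : ∀ m, Function.LeftInverse Λinv^[m] Λ^[m] := fun m => hl.iterate m
  have hrm : ∀ m, Function.RightInverse Λinv^[m] Λ^[m] := fun m => hr.iterate m
  have hcl : ∀ M : ℕ, IsClosed (⋂ m ≥ M, Λ^[m] '' B) := fun M =>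
    isClosed_biInter fun m _ => (hB.image (hΛ.iterate m)).isClosed
  have himg : ∀ m z, z ∈ Λ^[m] '' B ↔ Λinv^[m] z ∈ B := fun m z => by
    constructor
    · rintro ⟨y, hy, rfl⟩; rwa [hlm]
    · exact fun h => ⟨_, h, hrm m z⟩
  obtain ⟨M, x, hx⟩ := nonempty_interior_of_iUnion_of_closed hcl (by
    refine eq_univ_of_forall fun z => ?_
    obtain ⟨M, hM⟩ := eventually_atTop.1 ((hdil z).eventually_mem hBx)
    exact mem_iUnion.2 ⟨M, mem_iInter₂.2 fun m hm => (himg m z).2 (hM m hm)⟩)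
  refine ⟨Λ^[M] ⁻¹' interior (⋂ m ≥ M, Λ^[m] '' B),
    isOpen_interior.preimage (hΛ.iterate M), ⟨Λinv^[M] x, ?_⟩, fun z hz m => ?_⟩
  · rwa [mem_preimage, hrm M x]
  · have h1 := mem_iInter₂.1 (interior_subset hz) (m + M) (Nat.le_add_left M m)
    rwa [himg, Function.iterate_add_apply, hlm M z] at h1

theorem hasStrictFDerivAt_of_differentiable_complex {E F : Type*} [NormedAddCommGroup E]
    [NormedSpace ℂ E] [ProperSpace E] [NormedAddCommGroup F] [NormedSpace ℂ F] {f : E → F}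
    (hf : Differentiable ℂ f) (a : E) : HasStrictFDerivAt f (fderiv ℂ f a) a := by
  refine hasStrictFDerivAt_of_hasFDerivAt_of_continuousAt
    (Eventually.of_forall fun x => (hf x).hasFDerivAt) ?_
  have huc :=
    (isCompact_closedBall a 2).uniformContinuousOn_of_continuous hf.continuous.continuousOn
  rw [Metric.uniformContinuousOn_iff] at huc
  rw [Metric.continuousAt_iff]
  intro ε hε
  obtain ⟨δ, hδ, h⟩ := huc (ε / 4) (by positivity)
  refine ⟨min δ 1, by positivity, fun {w} hw => ?_⟩
  have hwa : ∀ u ∈ ball (0 : E) 1, dist (f (w + u)) (f (a + u)) < ε / 4 := fun u hu => by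
    rw [mem_ball_zero_iff] at hu
    rw [lt_min_iff] at hw
    refine h _ ?_ _ ?_ ?_
    · rw [mem_closedBall, dist_eq_norm, add_sub_right_comm]
      have := norm_add_le (w - a) u
      rw [dist_eq_norm] at hw; linarith
    · rw [mem_closedBall, dist_eq_norm, add_sub_cancel_left]; linarith
    · rw [dist_add_right]; exact hw.1
  have hd : Differentiable ℂ fun u => f (w + u) - f (a + u) := by fun_prop
  have hm : MapsTo (fun u => f (w + u) - f (a + u)) (ball 0 1)
      (closedBall (f (w + 0) - f (a + 0)) (ε / 2)) := fun u hu => by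
    have h1 := hwa u hu
    have h2 := hwa 0 (mem_ball_self one_pos)
    rw [dist_eq_norm] at h1 h2
    rw [mem_closedBall, dist_eq_norm]
    exact (norm_sub_le _ _).trans (by linarith)
  have h1 := Complex.norm_fderiv_le_div_of_mapsTo_ball hd.differentiableOn hm one_pos
  have h2 : fderiv ℂ (fun u => f (w + u) - f (a + u)) 0 = fderiv ℂ f w - fderiv ℂ f a := by
    rw [fderiv_fun_sub (by fun_prop) (by fun_prop), fderiv_comp_add_left, fderiv_comp_add_left,
      add_zero, add_zero]
  rw [h2, div_one] at h1
  rw [dist_eq_norm]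
  linarith

theorem HasStrictFDerivAt.exists_forall_norm_sub_le {E F : Type*} [NormedAddCommGroup E]
    [NormedSpace ℂ E] [NormedAddCommGroup F] [NormedSpace ℂ F] {f : E → F} {f' : E →L[ℂ] F} {a : E}
    (hf : HasStrictFDerivAt f f' a) {κ : ℝ} (hκ : 0 < κ) :
    ∃ U ∈ 𝓝 a, ∀ w ∈ U, ∀ w' ∈ U, ‖f w - f w' - f' (w - w')‖ ≤ κ * ‖w - w'‖ := by
  obtain ⟨U, hU, h⟩ := hf.approximates_deriv_on_nhds (c := ⟨κ, hκ.le⟩) (Or.inr hκ)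
  exact ⟨U, hU, fun w hw w' hw' => h w hw w' hw'⟩

/-- An approximate backward orbit of a linear map with a dominated splitting, starting at a nonzero
vector of the contracted subspace, is unbounded. -/
theorem false_of_backward_orbits {E : Type*} [NormedAddCommGroup E] [NormedSpace ℂ E]
    {L p : E →L[ℂ] E} {α : ℝ} (hα : 0 < α) (hα1 : α ≤ 1) (hLp : L * p = p * L)
    (h1 : ∀ x, ‖L (p x)‖ ≤ α / 8 * ‖p x‖) (h2 : ∀ x, 8 * α * ‖x - p x‖ ≤ ‖L (x - p x)‖)
    {κ : ℝ} (hp : ‖p‖ * κ ≤ α / 8) (hq : (1 + ‖p‖) * κ ≤ α / 8)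
    {Δ : ℕ → E} (hΔ : ∀ m, ‖Δ m - L (Δ (m + 1))‖ ≤ κ * ‖Δ (m + 1)‖) {M : ℝ}
    (hM : ∀ m, ‖Δ m‖ ≤ M) (h0 : Δ 0 ≠ 0) (hp0 : p (Δ 0) = Δ 0) : False := by
  have hx : ∀ m, ‖p (Δ m)‖ ≤
      α / 8 * ‖p (Δ (m + 1))‖ + α / 8 * (‖p (Δ (m + 1))‖ + ‖Δ (m + 1) - p (Δ (m + 1))‖) := by
    intro m
    have e1 : p (Δ m) = L (p (Δ (m + 1))) + p (Δ m - L (Δ (m + 1))) := by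
      have : L (p (Δ (m + 1))) = p (L (Δ (m + 1))) := DFunLike.congr_fun hLp _
      rw [this, map_sub]; abel
    have e2 : ‖p (Δ m - L (Δ (m + 1)))‖ ≤
        α / 8 * (‖p (Δ (m + 1))‖ + ‖Δ (m + 1) - p (Δ (m + 1))‖) := by
      have e3 : ‖Δ (m + 1)‖ ≤ ‖p (Δ (m + 1))‖ + ‖Δ (m + 1) - p (Δ (m + 1))‖ :=
        (norm_le_insert' _ _).trans_eq rfl
      calc _ ≤ ‖p‖ * (κ * ‖Δ (m + 1)‖) := p.le_opNorm_of_le (hΔ m)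
        _ = (‖p‖ * κ) * ‖Δ (m + 1)‖ := by ring
        _ ≤ _ := by gcongr
    rw [e1]
    exact (norm_add_le _ _).trans (add_le_add (h1 _) e2)
  have hy : ∀ m, 8 * α * ‖Δ (m + 1) - p (Δ (m + 1))‖ ≤ ‖Δ m - p (Δ m)‖ +
      α / 8 * (‖p (Δ (m + 1))‖ + ‖Δ (m + 1) - p (Δ (m + 1))‖) := by
    intro m
    set r := Δ m - L (Δ (m + 1))
    have e1 : L (Δ (m + 1) - p (Δ (m + 1))) = (Δ m - p (Δ m)) - (r - p r) := by
      have : L (p (Δ (m + 1))) = p (L (Δ (m + 1))) := DFunLike.congr_fun hLp _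
      simp only [r, map_sub, this]; abel
    have e2 : ‖r - p r‖ ≤ α / 8 * (‖p (Δ (m + 1))‖ + ‖Δ (m + 1) - p (Δ (m + 1))‖) := by
      have e3 : ‖Δ (m + 1)‖ ≤ ‖p (Δ (m + 1))‖ + ‖Δ (m + 1) - p (Δ (m + 1))‖ :=
        (norm_le_insert' _ _).trans_eq rfl
      calc _ ≤ ‖r‖ + ‖p r‖ := norm_sub_le _ _
        _ ≤ κ * ‖Δ (m + 1)‖ + ‖p‖ * (κ * ‖Δ (m + 1)‖) :=
          add_le_add (hΔ m) (p.le_opNorm_of_le (hΔ m))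
        _ = ((1 + ‖p‖) * κ) * ‖Δ (m + 1)‖ := by ring
        _ ≤ _ := by gcongr
    have e4 := h2 (Δ (m + 1))
    rw [e1] at e4
    exact e4.trans ((norm_sub_le _ _).trans (add_le_add le_rfl e2))
  have hcone : ∀ m, ‖Δ m - p (Δ m)‖ ≤ ‖p (Δ m)‖ ∧ 2 ^ m * ‖p (Δ 0)‖ ≤ ‖p (Δ m)‖ := by
    intro m
    induction m with
    | zero => simp [hp0]
    | succ m ih =>
      have a1 := hx m
      have a2 := hy m
      set x := ‖p (Δ (m + 1))‖
      set y := ‖Δ (m + 1) - p (Δ (m + 1))‖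
      have hx0 : 0 ≤ x := norm_nonneg _
      have hy0 : 0 ≤ y := norm_nonneg _
      have hyx : y ≤ x := by
        by_contra! hlt
        have b1 : α * x ≤ α * y := mul_le_mul_of_nonneg_left hlt.le hα.le
        have b2 : 0 < α * y := mul_pos hα (hx0.trans_lt hlt)
        nlinarith [ih.1]
      refine ⟨hyx, ?_⟩
      have b1 : α * y ≤ α * x := mul_le_mul_of_nonneg_left hyx hα.le
      have b2 : α * x ≤ 1 * x := mul_le_mul_of_nonneg_right hα1 hx0
      rw [pow_succ]
      nlinarith [ih.2]
  have hpos : 0 < ‖p (Δ 0)‖ := by rwa [hp0, norm_pos_iff]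
  obtain ⟨m, hm⟩ := pow_unbounded_of_one_lt (‖p‖ * M / ‖p (Δ 0)‖) one_lt_two
  rw [div_lt_iff₀ hpos] at hm
  exact (hm.trans_le (hcone m).2).not_ge (p.le_opNorm_of_le (hM m))

theorem eq_zero_of_tendsto_pow_fderiv {k : ℕ} {f φ Λ Λinv : (Fin k → ℂ) → (Fin k → ℂ)}
    {a : Fin k → ℂ} (hf : Differentiable ℂ f) (hfix : f a = a)
    (hφd : Differentiable ℂ φ) (hφopen : IsOpenMap φ) (hφ0 : φ 0 = a)
    (hΛd : Differentiable ℂ Λ)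
    (hconj : ∀ z, f (φ z) = φ (Λ z))
    (hΛinv : ∀ z, Λ (Λinv z) = z ∧ Λinv (Λ z) = z)
    (hdil : ∀ z, Tendsto (fun m => Λinv^[m] z) atTop (nhds (0 : Fin k → ℂ)))
    (x : Fin k → ℂ) (hx : Tendsto (fun m => (fderiv ℂ f a ^ m) x) atTop (𝓝 0)) : x = 0 := by
  by_contra hx0
  obtain ⟨N, p, α, e, hα, hα1, hAp, hpp, he, hpe, h1, h2⟩ :=
    (fderiv ℂ f a).exists_dominated_splitting hx0 hx
  obtain ⟨κ, hκ, hκ1⟩ : ∃ κ > 0, (1 + ‖p‖) * κ = α / 8 :=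
    ⟨α / 8 / (1 + ‖p‖), by positivity, by field_simp⟩
  have hstrict : HasStrictFDerivAt f^[N] (fderiv ℂ f a ^ N) a := by
    have := hasStrictFDerivAt_of_differentiable_complex (hf.iterate N) a
    rwa [((hf a).hasFDerivAt.iterate hfix N).fderiv] at this
  obtain ⟨U, hU, hUκ⟩ := hstrict.exists_forall_norm_sub_le hκ
  have hU' : φ ⁻¹' (U ∩ ball a 1) ∈ 𝓝 0 :=
    hφd.continuous.continuousAt.preimage_mem_nhds
      (hφ0.symm ▸ inter_mem hU (ball_mem_nhds a one_pos))
  obtain ⟨ε, hε, hεU⟩ := Metric.nhds_basis_closedBall.mem_iff.1 hU'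
  obtain ⟨O, hO, ⟨z, hz⟩, hOm⟩ := exists_isOpen_forall_iterate_mem hΛd.continuous
    (fun z => (hΛinv z).2) (fun z => (hΛinv z).1) hdil (isCompact_closedBall 0 ε)
    (closedBall_mem_nhds 0 hε)
  obtain ⟨z', hz', c, hc, hzc⟩ : ∃ z' ∈ O, ∃ c : ℂ, c ≠ 0 ∧ φ z' = φ z + c • e := by
    have h3 : φ '' O ∈ 𝓝 (φ z) := (hφopen O hO).mem_nhds (mem_image_of_mem _ hz)
    have h4 : Tendsto (fun c : ℂ => φ z + c • e) (𝓝[≠] 0) (𝓝 (φ z)) := by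
      have : Continuous fun c : ℂ => φ z + c • e := by fun_prop
      simpa using (this.tendsto 0).mono_left nhdsWithin_le_nhds
    obtain ⟨c, ⟨z', hz', h5⟩, hc⟩ := ((h4.eventually_mem h3).and eventually_mem_nhdsWithin).exists
    exact ⟨z', hz', c, hc, h5⟩
  have hback : ∀ y m, f^[N] (φ (Λinv^[N * (m + 1)] y)) = φ (Λinv^[N * m] y) := fun y m => by
    have h3 : f^[N] (φ (Λinv^[N * (m + 1)] y)) = φ (Λ^[N] (Λinv^[N * (m + 1)] y)) :=
      ((show Function.Semiconj φ Λ f from fun z => (hconj z).symm).iterate_right N _).symm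
    rw [h3, Nat.mul_succ, Nat.add_comm, Function.iterate_add_apply,
      (show Function.RightInverse Λinv Λ from fun z => (hΛinv z).1).iterate N]
  have hmem : ∀ y ∈ O, ∀ m, φ (Λinv^[m] y) ∈ U ∩ ball a 1 := fun y hy m => hεU (hOm y hy m)
  have hΔ : ∀ m, ‖(φ (Λinv^[N * m] z') - φ (Λinv^[N * m] z)) - (fderiv ℂ f a ^ N)
      (φ (Λinv^[N * (m + 1)] z') - φ (Λinv^[N * (m + 1)] z))‖ ≤
      κ * ‖φ (Λinv^[N * (m + 1)] z') - φ (Λinv^[N * (m + 1)] z)‖ := fun m => by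
    have h3 := hUκ _ (hmem z' hz' (N * (m + 1))).1 _ (hmem z hz (N * (m + 1))).1
    rwa [hback, hback] at h3
  have hM : ∀ m, ‖φ (Λinv^[N * m] z') - φ (Λinv^[N * m] z)‖ ≤ 2 := fun m => by
    have h3 := mem_ball.1 (hmem z' hz' (N * m)).2
    have h4 := mem_ball.1 (hmem z hz (N * m)).2
    rw [← dist_eq_norm]
    exact (dist_triangle_right _ _ a).trans (by linarith)
  have h0 : φ (Λinv^[N * 0] z') - φ (Λinv^[N * 0] z) = c • e := by
    rw [Nat.mul_zero, Function.iterate_zero_apply, Function.iterate_zero_apply, hzc,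
      add_sub_cancel_left]
  have hLp : fderiv ℂ f a ^ N * p = p * fderiv ℂ f a ^ N :=
    Commute.pow_left (show Commute (fderiv ℂ f a) p from hAp) N
  generalize fderiv ℂ f a ^ N = L at *
  refine false_of_backward_orbits hα hα1 hLp h1 h2 (by rw [← hκ1]; gcongr; linarith) hκ1.le
    (Δ := fun m => φ (Λinv^[N * m] z') - φ (Λinv^[N * m] z)) hΔ hM ?_ ?_
  · exact h0 ▸ smul_ne_zero hc he
  · rw [h0, map_smul, hpe]

section LineHolomorphic

theorem differentiableOn_intervalIntegral_of_continuousOn {S : Set ℂ} (hS : IsOpen S)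
    {g : ℂ → ℝ → ℂ} {a b : ℝ} (hc : ContinuousOn g.uncurry (S ×ˢ univ))
    (hd : ∀ θ, DifferentiableOn ℂ (fun t => g t θ) S) :
    DifferentiableOn ℂ (fun t => ∫ θ in a..b, g t θ) S := by
  intro t₀ ht₀
  obtain ⟨ρ, hρ, hρS⟩ := Metric.nhds_basis_closedBall.mem_iff.1 (hS.mem_nhds ht₀)
  have hcont : ∀ t ∈ S, Continuous (g t) := fun t ht =>
    hc.comp_continuous (by fun_prop : Continuous fun θ : ℝ => (t, θ)) fun θ => ⟨ht, mem_univ _⟩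
  have hK := (isCompact_closedBall t₀ ρ).prod (isCompact_uIcc (a := a) (b := b))
  obtain ⟨M, hM⟩ := hK.exists_bound_of_continuousOn
    (hc.mono (prod_mono hρS (subset_univ _)))
  have hder : ∀ θ, ∀ t ∈ S, HasDerivAt (fun t => g t θ) (deriv (fun t => g t θ) t) t :=
    fun θ t ht => ((hd θ).differentiableAt (hS.mem_nhds ht)).hasDerivAt
  have key := intervalIntegral.hasDerivAt_integral_of_dominated_loc_of_deriv_le
    (μ := MeasureTheory.volume) (a := a) (b := b) (F := g)
    (F' := fun t θ => deriv (fun t => g t θ) t) (x₀ := t₀) (s := ball t₀ (ρ / 2))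
    (bound := fun _ => M / (ρ / 2)) (ball_mem_nhds _ (by positivity))
    (by
      filter_upwards [hS.mem_nhds ht₀] with t ht using (hcont t ht).aestronglyMeasurable)
    ((hcont t₀ ht₀).intervalIntegrable _ _)
    (by
      obtain ⟨u, -, hu⟩ := exists_seq_strictAnti_tendsto (0 : ℝ)
      refine aestronglyMeasurable_of_tendsto_ae (atTop : Filter ℕ)
        (f := fun n θ => ((ρ / (n + 1) : ℝ) : ℂ)⁻¹ • (g (t₀ + (ρ / (n + 1) : ℝ)) θ - g t₀ θ))
        (fun n => ?_) (MeasureTheory.ae_of_all _ fun θ => ?_)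
      · have hmem : t₀ + (ρ / (n + 1) : ℝ) ∈ S := hρS ?_
        · exact (((hcont _ hmem).sub (hcont _ ht₀)).const_smul
            (((ρ / (n + 1) : ℝ) : ℂ)⁻¹)).aestronglyMeasurable
        rw [mem_closedBall, dist_eq_norm, add_sub_cancel_left, Complex.norm_real,
          Real.norm_of_nonneg (by positivity)]
        exact div_le_self hρ.le (by linarith [n.cast_nonneg (α := ℝ)])
      · have h1 := (hder θ t₀ ht₀).tendsto_slope_zero
        refine h1.comp (tendsto_nhdsWithin_iff.2 ⟨?_, Eventually.of_forall fun n => ?_⟩)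
        · have := (tendsto_const_div_atTop_nhds_zero_nat ρ).comp (tendsto_add_atTop_nat 1)
          have h2 := (Complex.continuous_ofReal.tendsto 0).comp this
          simpa [Function.comp_def] using h2
        · simp only [mem_compl_iff, mem_singleton_iff, Complex.ofReal_eq_zero]
          positivity)
    (by
      refine MeasureTheory.ae_of_all _ fun θ hθ t ht => ?_
      have hsub : closedBall t (ρ / 2) ⊆ closedBall t₀ ρ :=
        closedBall_subset_closedBall' (by linarith [mem_ball.1 ht])
      refine Complex.norm_deriv_le_of_forall_mem_sphere_norm_le (by positivity)
        (((hd θ).mono ?_).diffContOnCl (s := ball t (ρ / 2))) fun z hz =>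
          hM (z, θ) ⟨hsub (sphere_subset_closedBall hz), uIoc_subset_uIcc hθ⟩
      exact closure_ball_subset_closedBall.trans (hsub.trans hρS))
    intervalIntegrable_const
    (MeasureTheory.ae_of_all _ fun θ _ t ht => hder θ t (hρS (ball_subset_closedBall
      (ball_subset_ball (by linarith) ht))))
  exact key.2.differentiableAt.differentiableWithinAt

variable {E : Type*} [NormedAddCommGroup E] [NormedSpace ℂ E]

/-- A function that is continuous on `U` and holomorphic along every complex line. -/
def LineHolOn (F : E → ℂ) (U : Set E) : Prop :=
  ContinuousOn F U ∧
    ∀ v u : E, DifferentiableOn ℂ (fun t : ℂ => F (v + t • u)) ((fun t : ℂ => v + t • u) ⁻¹' U)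

namespace LineHolOn

variable {F G : E → ℂ} {U W : Set E}

theorem mono (hF : LineHolOn F U) (h : W ⊆ U) : LineHolOn F W :=
  ⟨hF.1.mono h, fun v u => (hF.2 v u).mono (preimage_mono h)⟩

theorem congr (hF : LineHolOn F U) (h : EqOn G F U) : LineHolOn G U :=
  ⟨hF.1.congr h, fun v u => (hF.2 v u).congr fun _ ht => h ht⟩

theorem const (c : ℂ) : LineHolOn (fun _ => c) U :=
  ⟨continuousOn_const, fun _ _ => differentiableOn_const c⟩

theorem add (hF : LineHolOn F U) (hG : LineHolOn G U) : LineHolOn (fun p => F p + G p) U :=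
  ⟨hF.1.add hG.1, fun v u => (hF.2 v u).add (hG.2 v u)⟩

theorem mul (hF : LineHolOn F U) (hG : LineHolOn G U) : LineHolOn (fun p => F p * G p) U :=
  ⟨hF.1.mul hG.1, fun v u => (hF.2 v u).mul (hG.2 v u)⟩

theorem div (hF : LineHolOn F U) (hG : LineHolOn G U) (h : ∀ p ∈ U, G p ≠ 0) :
    LineHolOn (fun p => F p / G p) U :=
  ⟨hF.1.div hG.1 h, fun v u => (hF.2 v u).div (hG.2 v u) fun _ ht => h _ ht⟩

theorem pow (hF : LineHolOn F U) (n : ℕ) : LineHolOn (fun p => F p ^ n) U :=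
  ⟨hF.1.pow n, fun v u => (hF.2 v u).pow n⟩

theorem sum {ι : Type*} {s : Finset ι} {f : ι → E → ℂ} (h : ∀ i ∈ s, LineHolOn (f i) U) :
    LineHolOn (fun p => ∑ i ∈ s, f i p) U :=
  ⟨continuousOn_finsetSum _ fun i hi => (h i hi).1,
    fun v u => DifferentiableOn.fun_sum fun i hi => (h i hi).2 v u⟩

theorem of_nhds (h : ∀ p ∈ U, ∃ W ∈ 𝓝 p, LineHolOn F W) : LineHolOn F U := by
  refine ⟨fun p hp => ?_, fun v u t ht => ?_⟩
  · obtain ⟨W, hW, hF⟩ := h p hp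
    exact (hF.1.continuousAt hW).continuousWithinAt
  · obtain ⟨W, hW, hF⟩ := h _ ht
    have hcont : Continuous fun t : ℂ => v + t • u := by fun_prop
    exact ((hF.2 v u).differentiableAt (hcont.continuousAt hW)).differentiableWithinAt

theorem circleIntegral (hG : LineHolOn G U) (hW : IsOpen W) {c : ℂ → ℂ} {r : ℝ} (hr : 0 ≤ r)
    (hc : ContinuousOn c (sphere 0 r)) {e : E}
    (h : ∀ p ∈ W, ∀ x ∈ sphere (0 : ℂ) r, p + x • e ∈ U) :
    LineHolOn (fun p => ∮ x in C(0, r), c x * G (p + x • e)) W := by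
  have hcm : Continuous fun θ => c (circleMap 0 r θ) :=
    hc.comp_continuous (continuous_circleMap 0 r) fun θ => circleMap_mem_sphere 0 hr θ
  have hdc : Continuous fun θ => deriv (circleMap 0 r) θ := by
    simp only [deriv_circleMap]; fun_prop
  refine ⟨?_, fun v u => ?_⟩
  · rw [continuousOn_iff_continuous_domRestrict]
    refine intervalIntegral.continuous_parametric_intervalIntegral_of_continuous' ?_ _ _
    have h1 : Continuous fun q : W × ℝ => G (q.1.1 + circleMap 0 r q.2 • e) :=
      hG.1.comp_continuous (by fun_prop) fun q => h _ q.1.2 _ (circleMap_mem_sphere 0 hr _)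
    exact (hdc.comp continuous_snd).smul ((hcm.comp continuous_snd).mul h1)
  · have hS : IsOpen ((fun t : ℂ => v + t • u) ⁻¹' W) :=
      hW.preimage (by fun_prop)
    refine differentiableOn_intervalIntegral_of_continuousOn hS ?_ fun θ => ?_
    · have h1 : ContinuousOn (fun q : ℂ × ℝ => G (v + q.1 • u + circleMap 0 r q.2 • e))
          (((fun t : ℂ => v + t • u) ⁻¹' W) ×ˢ univ) :=
        hG.1.comp (by fun_prop) fun q hq => h _ hq.1 _ (circleMap_mem_sphere 0 hr _)
      exact (hdc.comp continuous_snd).continuousOn.smul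
        ((hcm.comp continuous_snd).continuousOn.mul h1)
    · refine DifferentiableOn.const_smul ((differentiableOn_const (c (circleMap 0 r θ))).mul
        (((hG.2 (v + circleMap 0 r θ • e) u).mono
          fun t ht => ?_).congr fun t _ => ?_)) (deriv (circleMap 0 r) θ)
      · have := h _ ht _ (circleMap_mem_sphere 0 hr θ)
        simpa only [mem_preimage, add_right_comm] using this
      · simp only [add_right_comm]

/-- The derivative in a fixed direction of a line-holomorphic function. -/
theorem deriv_line (hF : LineHolOn F U) (hU : IsOpen U) (e : E) :
    LineHolOn (fun p => deriv (fun t : ℂ => F (p + t • e)) 0) U := by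
  refine of_nhds fun p hp => ?_
  have hcont : Continuous fun q : E × ℂ => q.1 + q.2 • e := by fun_prop
  obtain ⟨r, hr, hrU⟩ := Metric.nhds_basis_closedBall.mem_iff.1
    (hcont.continuousAt.preimage_mem_nhds (x := (p, 0)) (by simpa using hU.mem_nhds hp))
  have hmem : ∀ q ∈ ball p r, ∀ x ∈ closedBall (0 : ℂ) r, q + x • e ∈ U := fun q hq x hx =>
    @hrU (q, x) (by
      rw [← closedBall_prod_same]; exact ⟨ball_subset_closedBall hq, hx⟩)
  refine ⟨ball p r, ball_mem_nhds _ hr, ?_⟩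
  have hc : ContinuousOn (fun x : ℂ => (2 * Real.pi * Complex.I : ℂ)⁻¹ * (x ^ 2)⁻¹) (sphere 0 r) :=
    continuousOn_const.mul ((continuousOn_pow 2).inv₀ fun x hx =>
      pow_ne_zero _ (ne_of_mem_sphere hx hr.ne'))
  refine (hF.circleIntegral isOpen_ball hr.le hc fun q hq x hx =>
    hmem q hq x (sphere_subset_closedBall hx)).congr fun q hq => ?_
  have hd : DifferentiableOn ℂ (fun t : ℂ => F (q + t • e)) ((fun t : ℂ => q + t • e) ⁻¹' U) :=
    hF.2 q e
  have := DifferentiableOn.deriv_eq_smul_circleIntegral hr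
    (hd.mono fun x hx => hmem q hq x hx)
  simp only [sub_zero, smul_eq_mul, one_div] at this
  simp only [mul_assoc, circleIntegral.integral_const_mul, this]
  field_simp [Complex.I_ne_zero, Real.pi_ne_zero]

end LineHolOn

end LineHolomorphic

section ArgumentPrinciple

variable {h : ℂ → ℂ} {O : Set ℂ} {r : ℝ}

theorem not_eventually_eq_zero_of_sphere (hO : IsOpen O) (hr : 0 < r)
    (hsub : closedBall 0 r ⊆ O) (hd : DifferentiableOn ℂ h O) (hs : ∀ z ∈ sphere (0 : ℂ) r, h z ≠ 0)
    {z : ℂ} (hz : z ∈ closedBall (0 : ℂ) r) : ¬ ∃ᶠ w in 𝓝[≠] z, h w = 0 := by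
  intro hfr
  have hA : AnalyticOnNhd ℂ h (closedBall 0 r) := (hd.analyticOnNhd hO).mono hsub
  have hr' : (r : ℂ) ∈ sphere (0 : ℂ) r := by simp [abs_of_pos hr]
  exact hs r hr' (hA.eqOn_zero_of_preconnected_of_frequently_eq_zero
    (convex_closedBall (0 : ℂ) r).isPreconnected hz hfr (sphere_subset_closedBall hr'))

theorem finite_zeros_closedBall (hO : IsOpen O) (hr : 0 < r)
    (hsub : closedBall 0 r ⊆ O) (hd : DifferentiableOn ℂ h O)
    (hs : ∀ z ∈ sphere (0 : ℂ) r, h z ≠ 0) : {z ∈ closedBall (0 : ℂ) r | h z = 0}.Finite := by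
  by_contra hinf
  obtain ⟨z, hz, hacc⟩ := Set.Infinite.exists_accPt_of_subset_isCompact hinf
    (isCompact_closedBall (0 : ℂ) r) (sep_subset _ _)
  refine not_eventually_eq_zero_of_sphere hO hr hsub hd hs hz ?_
  exact (accPt_iff_frequently_nhdsNE.1 hacc).mono fun w hw => hw.2

theorem exists_factor_of_differentiableOn (hO : IsOpen O) (hd : DifferentiableOn ℂ h O) {z₀ : ℂ}
    (hz₀ : z₀ ∈ O) (h0 : ¬ ∀ᶠ w in 𝓝 z₀, h w = 0) :
    ∃ (m : ℕ) (g : ℂ → ℂ), DifferentiableOn ℂ g O ∧ g z₀ ≠ 0 ∧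
      ∀ z ∈ O, h z = (z - z₀) ^ m * g z := by
  obtain ⟨m, g₀, hg₀, hne, heq⟩ :=
    (hd.analyticAt (hO.mem_nhds hz₀)).exists_eventuallyEq_pow_smul_nonzero_iff.2 h0
  have hgz : Function.update (fun z => h z / (z - z₀) ^ m) z₀ (g₀ z₀) =ᶠ[𝓝 z₀] g₀ := by
    filter_upwards [heq] with z hz
    rcases eq_or_ne z z₀ with rfl | hzz
    · simp
    · have := sub_ne_zero.2 hzz
      rw [Function.update_of_ne hzz, hz]; simp [this]
  refine ⟨m, Function.update (fun z => h z / (z - z₀) ^ m) z₀ (g₀ z₀), fun z hz => ?_,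
    by simpa using hne, fun z hz => ?_⟩
  · rcases eq_or_ne z z₀ with rfl | hzz
    · exact (hg₀.differentiableAt.congr_of_eventuallyEq hgz).differentiableWithinAt
    · have h1 : DifferentiableAt ℂ (fun z => h z / (z - z₀) ^ m) z :=
        (hd.differentiableAt (hO.mem_nhds hz)).div (by fun_prop)
          (pow_ne_zero _ (sub_ne_zero.2 hzz))
      refine (h1.congr_of_eventuallyEq ?_).differentiableWithinAt
      filter_upwards [isOpen_ne.mem_nhds hzz] with w hw using Function.update_of_ne hw _ _
  · rcases eq_or_ne z z₀ with rfl | hzz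
    · simpa using heq.self_of_nhds
    · rw [Function.update_of_ne hzz, mul_div_cancel₀ _ (pow_ne_zero _ (sub_ne_zero.2 hzz))]

/-- The argument principle with weights. -/
theorem exists_multiset_zeros (hO : IsOpen O) (hr : 0 < r)
    (hsub : closedBall 0 r ⊆ O) (hd : DifferentiableOn ℂ h O)
    (hs : ∀ z ∈ sphere (0 : ℂ) r, h z ≠ 0) :
    ∃ s : Multiset ℂ, (∀ z, z ∈ s ↔ z ∈ ball (0 : ℂ) r ∧ h z = 0) ∧
      ∀ K : ℂ → ℂ, DifferentiableOn ℂ K O →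
        ∮ z in C(0, r), deriv h z / h z * K z = 2 * Real.pi * Complex.I * (s.map K).sum := by
  induction hn : {z ∈ closedBall (0 : ℂ) r | h z = 0}.ncard using Nat.strong_induction_on
    generalizing h with
  | _ n ih =>
  have hfin := finite_zeros_closedBall hO hr hsub hd hs
  by_cases hz : ∃ z₀ ∈ closedBall (0 : ℂ) r, h z₀ = 0
  · obtain ⟨z₀, hz₀, hz₀h⟩ := hz
    have hz₀b : z₀ ∈ ball (0 : ℂ) r := by
      rw [← ball_union_sphere] at hz₀
      exact hz₀.resolve_right fun hh => hs _ hh hz₀h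
    obtain ⟨m, g, hg, hgz₀, hhg⟩ := exists_factor_of_differentiableOn hO hd (hsub hz₀) fun hev =>
      not_eventually_eq_zero_of_sphere hO hr hsub hd hs hz₀
        (hev.filter_mono nhdsWithin_le_nhds).frequently
    have hm : m ≠ 0 := by
      rintro rfl
      exact hgz₀ (by simpa [hz₀h, eq_comm] using hhg z₀ (hsub hz₀))
    have hgs : ∀ z ∈ sphere (0 : ℂ) r, g z ≠ 0 := fun z hz hgz =>
      hs z hz (by rw [hhg z (hsub (sphere_subset_closedBall hz)), hgz, mul_zero])
    have hzero : ∀ z ∈ O, h z = 0 ↔ z = z₀ ∨ g z = 0 := fun z hz => by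
      rw [hhg z hz, mul_eq_zero, pow_eq_zero_iff hm, sub_eq_zero]
    obtain ⟨s, hs1, hs2⟩ := ih _ (by
      rw [← hn]
      refine Set.ncard_lt_ncard ⟨fun z hz => ⟨hz.1, (hzero z (hsub hz.1)).2 (Or.inr hz.2)⟩,
        fun hh => hgz₀ (hh ⟨hz₀, hz₀h⟩).2⟩ hfin) hg hgs rfl
    refine ⟨Multiset.replicate m z₀ + s, fun z => ?_, fun K hK => ?_⟩
    · rw [Multiset.mem_add, hs1, Multiset.mem_replicate]
      constructor
      · rintro (⟨-, rfl⟩ | ⟨hz, hgz⟩)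
        · exact ⟨hz₀b, hz₀h⟩
        · exact ⟨hz, (hzero z (hsub (ball_subset_closedBall hz))).2 (Or.inr hgz)⟩
      · rintro ⟨hz, hhz⟩
        exact ((hzero z (hsub (ball_subset_closedBall hz))).1 hhz).imp (fun h => ⟨hm, h⟩)
          fun h => ⟨hz, h⟩
    · have hI : ∀ z ∈ sphere (0 : ℂ) r, deriv h z / h z * K z =
          (m : ℂ) * ((z - z₀)⁻¹ * K z) + deriv g z / g z * K z := by
        intro z hz
        have hzO : z ∈ O := hsub (sphere_subset_closedBall hz)
        have hzz : z - z₀ ≠ 0 := fun hh => hs z hz (by rw [hhg z hzO, hh]; simp [hm])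
        have hder : deriv h z = m * (z - z₀) ^ (m - 1) * g z + (z - z₀) ^ m * deriv g z := by
          have h1 : h =ᶠ[𝓝 z] fun z => (z - z₀) ^ m * g z := by
            filter_upwards [hO.mem_nhds hzO] with w hw using hhg w hw
          rw [h1.deriv_eq]
          have h2 : HasDerivAt (fun z => (z - z₀) ^ m * g z) _ z :=
            (((hasDerivAt_id z).sub_const z₀).pow m).mul
            (hg.differentiableAt (hO.mem_nhds hzO)).hasDerivAt
          simpa using h2.deriv
        obtain ⟨m, rfl⟩ := Nat.exists_eq_succ_of_ne_zero hm
        have := hgs z hz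
        rw [hder, hhg z hzO]
        simp only [Nat.succ_eq_add_one, Nat.add_sub_cancel]
        field_simp
        ring
      have hcK : ContinuousOn K (sphere 0 r) :=
        hK.continuousOn.mono (sphere_subset_closedBall.trans hsub)
      have hcg : ContinuousOn g (sphere 0 r) :=
        hg.continuousOn.mono (sphere_subset_closedBall.trans hsub)
      have hcg' : ContinuousOn (deriv g) (sphere 0 r) :=
        (hg.deriv hO).continuousOn.mono (sphere_subset_closedBall.trans hsub)
      have hzz : ∀ z ∈ sphere (0 : ℂ) r, z - z₀ ≠ 0 := fun z hz hh => by
        rw [sub_eq_zero] at hh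
        exact hs z hz (hh ▸ hz₀h)
      have hi1 : CircleIntegrable (fun z => (m : ℂ) * ((z - z₀)⁻¹ * K z)) 0 r :=
        ContinuousOn.circleIntegrable hr.le (continuousOn_const.mul
          (((continuousOn_id.sub continuousOn_const).inv₀ hzz).mul hcK))
      have hi2 : CircleIntegrable (fun z => deriv g z / g z * K z) 0 r :=
        ContinuousOn.circleIntegrable hr.le ((hcg'.div hcg hgs).mul hcK)
      have hcau := (hK.mono hsub).circleIntegral_sub_inv_smul hz₀b
      simp only [smul_eq_mul] at hcau
      rw [circleIntegral.integral_congr hr.le hI, circleIntegral.integral_add hi1 hi2,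
        circleIntegral.integral_const_mul, hcau, hs2 K hK]
      simp
      ring
  · push Not at hz
    refine ⟨0, fun z => ?_, fun K hK => ?_⟩
    · simpa using fun hzb => hz z (by simpa using hzb.le)
    · have hd' : DifferentiableOn ℂ (fun z => deriv h z / h z * K z) (closedBall 0 r) :=
        (((hd.deriv hO).mono hsub).div (hd.mono hsub) hz).mul (hK.mono hsub)
      simpa using hd'.diffContOnCl_ball subset_rfl |>.circleIntegral_eq_zero hr.le

end ArgumentPrinciple

section Elimination

theorem Multiset.mul_esymm_eq_sum {R : Type*} [CommRing R] (s : Multiset R) (j : ℕ) :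
    j * s.esymm j = (-1) ^ (j + 1) * ∑ a ∈ Finset.HasAntidiagonal.antidiagonal j with a.1 < j,
      (-1) ^ a.1 * s.esymm a.1 * (s.map (· ^ a.2)).sum := by
  classical
  have h := congrArg (MvPolynomial.aeval fun i : s => (i : R)) (MvPolynomial.mul_esymm_eq_sum s R j)
  simp only [map_mul, map_sum, map_pow, map_neg, map_one, map_natCast,
    MvPolynomial.aeval_esymm_eq_multiset_esymm, Multiset.map_univ_coe] at h
  rw [h]
  congr 1
  refine Finset.sum_congr rfl fun a _ => ?_
  congr 1
  simp only [MvPolynomial.psum, map_sum, map_pow, MvPolynomial.aeval_X]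
  rw [Finset.sum_eq_multiset_sum, Multiset.map_univ s (fun x => x ^ a.2)]

variable {E : Type*} [NormedAddCommGroup E] [NormedSpace ℂ E]

theorem LineHolOn.multiset_esymm {W : Set E} {s : E → Multiset ℂ}
    (hs : ∀ j : ℕ, LineHolOn (fun p => ((s p).map (· ^ j)).sum) W) (j : ℕ) :
    LineHolOn (fun p => (s p).esymm j) W := by
  induction j using Nat.strong_induction_on with
  | _ j ih =>
  rcases Nat.eq_zero_or_pos j with rfl | hj
  · simpa [Multiset.esymm] using LineHolOn.const (U := W) (1 : ℂ)
  · refine ((LineHolOn.const (U := W) ((j : ℂ)⁻¹ * (-1) ^ (j + 1))).mul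
      (LineHolOn.sum (s := (Finset.HasAntidiagonal.antidiagonal j).filter fun a => a.1 < j)
        (f := fun a p => (-1) ^ a.1 * (s p).esymm a.1 * ((s p).map (· ^ a.2)).sum)
        fun a ha => ((LineHolOn.const _).mul (ih _ (Finset.mem_filter.1 ha).2)).mul
          (hs a.2))).congr fun p _ => ?_
    have hj' : (j : ℂ) ≠ 0 := by exact_mod_cast hj.ne'
    simp only [mul_assoc]
    have := (s p).mul_esymm_eq_sum j
    simp only [mul_assoc] at this
    rw [← this, inv_mul_cancel_left₀ hj']

theorem LineHolOn.span {U : Set E} {𝒢 : Set (E → ℂ)} (h : ∀ g ∈ 𝒢, LineHolOn g U) {K : E → ℂ}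
    (hK : K ∈ Submodule.span ℂ 𝒢) : LineHolOn K U := by
  induction hK using Submodule.span_induction with
  | mem g hg => exact h g hg
  | zero => exact LineHolOn.const 0
  | add _ _ _ _ h1 h2 => exact h1.add h2
  | smul c _ _ h1 => exact (LineHolOn.const c).mul h1

/-- The projection along a line of the common zero set of a family of line-holomorphic functions is
again a common zero set, if the zero set meets that line at an isolated point. -/
theorem LineHolOn.exists_elimination {U : Set E} (hU : IsOpen U) (h0U : (0 : E) ∈ U)
    {𝒢 : Set (E → ℂ)} (h𝒢 : ∀ g ∈ 𝒢, LineHolOn g U) {e : E} {r₀ : ℝ} (hr₀ : 0 < r₀)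
    (hiso : ∀ x : ℂ, ‖x‖ < r₀ → (∀ g ∈ 𝒢, g (x • e) = 0) → x = 0) :
    ∃ r, 0 < r ∧ r < r₀ ∧ ∃ W : Set E, IsOpen W ∧ 0 ∈ W ∧ ∃ 𝒬 : Set (E → ℂ),
      (∀ P ∈ 𝒬, LineHolOn P W) ∧ ∀ p ∈ W, (∀ x ∈ ball (0 : ℂ) r, p + x • e ∈ U) ∧
        ((∀ P ∈ 𝒬, P p = 0) ↔ ∃ x ∈ ball (0 : ℂ) r, ∀ g ∈ 𝒢, g (p + x • e) = 0) := by
  have hline : Continuous fun x : ℂ => x • e := by fun_prop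
  obtain ⟨r₁, hr₁, hr₁U⟩ := Metric.nhds_basis_ball.mem_iff.1
    (hline.continuousAt.preimage_mem_nhds (x := 0) (by simpa using hU.mem_nhds h0U))
  obtain ⟨H, hH𝒢, hH⟩ : ∃ H ∈ 𝒢, ∀ᶠ x : ℂ in 𝓝[≠] 0, H (x • e) ≠ 0 := by
    have hr2 : 0 < min r₀ r₁ / 2 := by positivity
    set x₀ : ℂ := ((min r₀ r₁ / 2 : ℝ) : ℂ) with hx₀
    have hx₀n : ‖x₀‖ = min r₀ r₁ / 2 := by
      rw [hx₀, Complex.norm_real, Real.norm_of_nonneg hr2.le]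
    have hx₀0 : x₀ ≠ 0 := by rw [← norm_pos_iff, hx₀n]; exact hr2
    have hx₀r : ‖x₀‖ < r₀ := by rw [hx₀n]; linarith [min_le_left r₀ r₁]
    have hx₀b : x₀ ∈ ball (0 : ℂ) r₁ := by
      rw [mem_ball_zero_iff, hx₀n]; linarith [min_le_right r₀ r₁]
    have : ∃ H ∈ 𝒢, H (x₀ • e) ≠ 0 := by
      by_contra! hh
      exact hx₀0 (hiso x₀ hx₀r hh)
    obtain ⟨H, hH𝒢, hH⟩ := this
    refine ⟨H, hH𝒢, ?_⟩
    have hd : DifferentiableOn ℂ (fun x : ℂ => H (x • e)) (ball 0 r₁) := by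
      have := (h𝒢 H hH𝒢).2 0 e
      simp only [zero_add] at this
      exact this.mono hr₁U
    have hA := hd.analyticOnNhd isOpen_ball
    refine ((hA 0 (mem_ball_self hr₁)).eventually_eq_zero_or_eventually_ne_zero).resolve_left
      fun hz => hH ?_
    exact hA.eqOn_zero_of_preconnected_of_eventuallyEq_zero
      (convex_ball (0 : ℂ) r₁).isPreconnected (mem_ball_self hr₁) hz hx₀b
  have hHL := h𝒢 H hH𝒢
  obtain ⟨r₂, hr₂, hr₂H⟩ := Metric.nhds_basis_ball.mem_iff.1 (eventually_nhdsWithin_iff.1 hH)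
  obtain ⟨r, hr, hrlt⟩ : ∃ r, 0 < r ∧ r < min r₀ (min r₁ r₂) :=
    exists_between (by positivity)
  have hrr₀ : r < r₀ := hrlt.trans_le (min_le_left _ _)
  have hrr₁ : r < r₁ := hrlt.trans_le ((min_le_right _ _).trans (min_le_left _ _))
  have hrr₂ : r < r₂ := hrlt.trans_le ((min_le_right _ _).trans (min_le_right _ _))
  refine ⟨r, hr, hrr₀, ?_⟩
  have hadd : Continuous fun q : E × ℂ => q.1 + q.2 • e := by fun_prop
  have hW₀ : ∀ᶠ p in 𝓝 (0 : E), ∀ x ∈ closedBall (0 : ℂ) r, p + x • e ∈ U := by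
    refine (isCompact_closedBall (0 : ℂ) r).eventually_forall_of_forall_eventually fun x hx =>
      hadd.continuousAt.preimage_mem_nhds (x := ((0 : E), x)) (hU.mem_nhds ?_)
    simpa using hr₁U (closedBall_subset_ball hrr₁ hx)
  have hW₁ : ∀ᶠ p in 𝓝 (0 : E), ∀ x ∈ sphere (0 : ℂ) r, H (p + x • e) ≠ 0 := by
    refine (isCompact_sphere (0 : ℂ) r).eventually_forall_of_forall_eventually fun x hx => ?_
    have hxU : (0 : E) + x • e ∈ U := by
      simpa using hr₁U (closedBall_subset_ball hrr₁ (sphere_subset_closedBall hx))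
    have hc : ContinuousAt (fun q : E × ℂ => H (q.1 + q.2 • e)) (0, x) :=
      ContinuousAt.comp (g := H) (hHL.1.continuousAt (hU.mem_nhds hxU)) hadd.continuousAt
    refine hc.eventually_ne ?_
    simpa using hr₂H (closedBall_subset_ball hrr₂ (sphere_subset_closedBall hx))
      (ne_of_mem_sphere hx hr.ne')
  obtain ⟨V, hV, hVo, h0V⟩ := _root_.eventually_nhds_iff.1 (hW₀.and hW₁)
  let h : E → ℂ → ℂ := fun p x => H (p + x • e)
  let O : E → Set ℂ := fun p => (fun x : ℂ => p + x • e) ⁻¹' U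
  have hO : ∀ p, IsOpen (O p) := fun p => hU.preimage (by fun_prop)
  have hroots : ∀ p, ∃ s : Multiset ℂ, p ∈ V → (∀ z, z ∈ s ↔ z ∈ ball (0 : ℂ) r ∧ h p z = 0) ∧
      ∀ K : ℂ → ℂ, DifferentiableOn ℂ K (O p) →
        ∮ z in C(0, r), deriv (h p) z / h p z * K z =
          2 * Real.pi * Complex.I * (s.map K).sum := by
    intro p
    by_cases hp : p ∈ V
    · obtain ⟨s, hs⟩ := exists_multiset_zeros (hO p) hr (h := h p)
        (fun x hx => (hV p hp).1 x hx) (hHL.2 p e) (hV p hp).2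
      exact ⟨s, fun _ => hs⟩
    · exact ⟨0, fun hp' => absurd hp' hp⟩
  choose s hs using hroots
  have hsum : ∀ K, LineHolOn K U →
      LineHolOn (fun p => ((s p).map fun x => K (p + x • e)).sum) V := by
    intro K hK
    have hG : LineHolOn (fun q => deriv (fun t : ℂ => H (q + t • e)) 0 / H q * K q)
        (U ∩ {q | H q ≠ 0}) :=
      (((hHL.deriv_line hU e).mono inter_subset_left).div (hHL.mono inter_subset_left)
        fun q hq => hq.2).mul (hK.mono inter_subset_left)
    refine (hG.circleIntegral hVo hr.le (c := fun _ => (2 * Real.pi * Complex.I : ℂ)⁻¹)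
      continuousOn_const (e := e) fun p hp x hx =>
        ⟨(hV p hp).1 x (sphere_subset_closedBall hx), (hV p hp).2 x hx⟩).congr fun p hp => ?_
    have h1 := (hs p hp).2 (fun x => K (p + x • e)) (hK.2 p e)
    have h2 : ∀ x, deriv (fun t : ℂ => H (p + x • e + t • e)) 0 = deriv (h p) x := by
      intro x
      have := deriv_comp_const_add (f := h p) x 0
      rw [add_zero] at this
      rw [← this]
      simp only [h, add_smul, add_assoc]
    simp only [h2, circleIntegral.integral_const_mul]
    rw [h1, inv_mul_cancel_left₀ (by simp [Real.pi_ne_zero])]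
  have hcard : LineHolOn (fun p => ((s p).card : ℂ)) V := by
    simpa using hsum _ (LineHolOn.const 1)
  let W := V ∩ (fun p => ((s p).card : ℂ)) ⁻¹' ball ((s 0).card : ℂ) 1
  have hWV : W ⊆ V := inter_subset_left
  have hWcard : ∀ p ∈ W, (s p).card = (s 0).card := fun p hp => by
    have := hp.2
    simp only [mem_preimage, mem_ball, dist_eq_norm] at this
    have h2 : ‖(((s p).card - (s 0).card : ℤ) : ℂ)‖ < 1 := by push_cast; exact this
    rw [Complex.norm_intCast] at h2
    have h3 : |((s p).card - (s 0).card : ℤ)| < 1 := by exact_mod_cast h2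
    have := Int.abs_lt_one_iff.1 h3
    omega
  refine ⟨W, hcard.1.isOpen_inter_preimage hVo isOpen_ball, ⟨h0V, by simp⟩,
    (fun K : E → ℂ => fun p => ((s p).map fun x => K (p + x • e)).prod) ''
      (Submodule.span ℂ 𝒢 : Set (E → ℂ)), ?_, fun p hp => ⟨fun x hx =>
      (hV p (hWV hp)).1 x (ball_subset_closedBall hx), fun hP => ?_, ?_⟩⟩
  · rintro _ ⟨K, hK, rfl⟩
    have hKL := LineHolOn.span h𝒢 hK
    refine ((LineHolOn.multiset_esymm (s := fun p => (s p).map fun x => K (p + x • e))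
      (fun j => ?_) (s 0).card).mono hWV).congr fun p hp => ?_
    · simpa [Function.comp_def] using hsum _ (hKL.pow j)
    · have hc : ((s p).map fun x => K (p + x • e)).card = (s 0).card := by
        rw [Multiset.card_map, hWcard p hp]
      rw [← hc]
      simp only [Multiset.esymm, Multiset.powersetCard_self, Multiset.map_singleton,
        Multiset.sum_singleton]
  · by_contra! hcon
    obtain ⟨K, hK, hne⟩ := Module.Dual.exists_forall_mem_ne_zero_of_forall_exists
      (Submodule.span ℂ 𝒢)
      (fun x : (s p).toFinset => (LinearMap.proj (p + x.1 • e) : (E → ℂ) →ₗ[ℂ] ℂ)) fun x => by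
        obtain ⟨g, hg, hne⟩ := hcon x ((((hs p (hWV hp)).1 x).1
          (Multiset.mem_toFinset.1 x.2)).1)
        exact ⟨g, Submodule.subset_span hg, hne⟩
    have := hP _ ⟨K, hK, rfl⟩
    rw [Multiset.prod_eq_zero_iff, Multiset.mem_map] at this
    obtain ⟨x, hx, hx0⟩ := this
    exact hne ⟨x, Multiset.mem_toFinset.2 hx⟩ hx0
  · rintro ⟨x, hx, hxg⟩ _ ⟨K, hK, rfl⟩
    refine Multiset.prod_eq_zero_iff.2 (Multiset.mem_map.2
      ⟨x, ((hs p (hWV hp)).1 x).2 ⟨hx, hxg H hH𝒢⟩, ?_⟩)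
    have hle : Submodule.span ℂ 𝒢 ≤
        LinearMap.ker (LinearMap.proj (p + x • e) : (E → ℂ) →ₗ[ℂ] ℂ) :=
      Submodule.span_le.2 fun g hg => hxg g hg
    exact hle hK

end Elimination

section Isolation

variable {E : Type*} [NormedAddCommGroup E] [NormedSpace ℂ E]

theorem LineHolOn.exists_projection {n : ℕ} {e : Fin n → E} {U : Set E} (hU : IsOpen U)
    (h0U : (0 : E) ∈ U) {𝒢 : Set (E → ℂ)} (h𝒢 : ∀ g ∈ 𝒢, LineHolOn g U) {r₀ : ℝ} (hr₀ : 0 < r₀)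
    (hiso : ∀ z : Fin n → ℂ, ‖z‖ < r₀ → (∀ g ∈ 𝒢, g (∑ i, z i • e i) = 0) → z = 0) :
    ∃ Z ∈ 𝓝 (0 : Fin n → ℂ), Z ⊆ ball 0 r₀ ∧ ∃ W : Set E, IsOpen W ∧ 0 ∈ W ∧
      ∃ 𝒬 : Set (E → ℂ), (∀ Q ∈ 𝒬, LineHolOn Q W) ∧ ∀ p ∈ W,
        (∀ z ∈ Z, p + ∑ i, z i • e i ∈ U) ∧
        ((∀ Q ∈ 𝒬, Q p = 0) ↔ ∃ z ∈ Z, ∀ g ∈ 𝒢, g (p + ∑ i, z i • e i) = 0) := by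
  induction n generalizing U 𝒢 r₀ with
  | zero =>
    refine ⟨ball 0 r₀, ball_mem_nhds _ hr₀, subset_rfl, U, hU, h0U, 𝒢, h𝒢, fun p hp => ?_⟩
    simp only [Finset.univ_eq_empty, Finset.sum_empty, add_zero]
    exact ⟨fun _ _ => hp, fun h => ⟨0, mem_ball_self hr₀, h⟩, fun ⟨_, _, h⟩ => h⟩
  | succ n ih =>
    have hcons : ∀ (x : ℂ) (z : Fin n → ℂ), ‖x‖ < r₀ → ‖z‖ < r₀ →
        ‖(Fin.cons x z : Fin (n + 1) → ℂ)‖ < r₀ := fun x z hx hz =>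
      (pi_norm_lt_iff hr₀).2 <| Fin.cases (by simpa using hx) fun i => by
        simpa using (norm_le_pi_norm z i).trans_lt hz
    obtain ⟨r, hr, hrr₀, W₁, hW₁, h0W₁, 𝒬₁, h𝒬₁, hiff₁⟩ :=
      LineHolOn.exists_elimination hU h0U h𝒢 (e := e 0) hr₀ fun x hx hg => by
        have := hiso (Fin.cons x 0) (hcons x 0 hx (by simpa using hr₀)) (by
          simpa [Fin.sum_univ_succ] using hg)
        simpa using congrFun this 0
    have hlin : Continuous fun z : Fin n → ℂ => ∑ i, z i • e i.succ := by fun_prop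
    obtain ⟨r₁, hr₁, hr₁W⟩ := Metric.nhds_basis_ball.mem_iff.1
      (hlin.continuousAt.preimage_mem_nhds (x := 0) (by simpa using hW₁.mem_nhds h0W₁))
    obtain ⟨Z, hZ, hZr, W, hW, h0W, 𝒬, h𝒬, hiff⟩ := ih (e := fun i => e i.succ) hW₁ h0W₁ h𝒬₁
      (lt_min hr₀ hr₁) fun z hz hQ => by
        have hzW : ∑ i, z i • e i.succ ∈ W₁ :=
          hr₁W (by simpa using hz.trans_le (min_le_right _ _))
        obtain ⟨x, hx, hxg⟩ := (hiff₁ _ hzW).2.1 hQ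
        have := hiso (Fin.cons x z) (hcons x z ((mem_ball_zero_iff.1 hx).trans hrr₀)
          (hz.trans_le (min_le_left _ _))) fun g hg => by
            simpa [Fin.sum_univ_succ, add_comm] using hxg g hg
        funext i
        simpa using congrFun this i.succ
    have hsum : ∀ (p : E) (z : Fin (n + 1) → ℂ), p + ∑ i, z i • e i =
        p + ∑ i : Fin n, z i.succ • e i.succ + z 0 • e 0 := fun p z => by
      rw [Fin.sum_univ_succ]; abel
    refine ⟨{z | z 0 ∈ ball (0 : ℂ) r ∧ (fun i : Fin n => z i.succ) ∈ Z}, ?_, fun z hz => ?_,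
      W, hW, h0W, 𝒬, h𝒬, fun p hp => ⟨fun z hz => ?_, ?_⟩⟩
    · refine inter_mem (s := {z : Fin (n + 1) → ℂ | z 0 ∈ ball (0 : ℂ) r})
        ((continuous_apply (0 : Fin (n + 1))).continuousAt.preimage_mem_nhds (ball_mem_nhds _ hr)) ?_
      have hc : Continuous fun (z : Fin (n + 1) → ℂ) (i : Fin n) => z i.succ := by fun_prop
      exact hc.continuousAt.preimage_mem_nhds (x := 0) hZ
    · have := hcons (z 0) (fun i => z i.succ) ((mem_ball_zero_iff.1 hz.1).trans hrr₀)
        ((mem_ball_zero_iff.1 (hZr hz.2)).trans_le (min_le_left _ _))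
      rw [mem_ball_zero_iff]
      exact (Fin.cons_self_tail z) ▸ this
    · rw [hsum]
      exact (hiff₁ _ ((hiff p hp).1 _ hz.2)).1 _ hz.1
    · rw [(hiff p hp).2]
      constructor
      · rintro ⟨z, hz, hQ⟩
        obtain ⟨x, hx, hxg⟩ := (hiff₁ _ ((hiff p hp).1 z hz)).2.1 hQ
        exact ⟨Fin.cons x z, ⟨by simpa using hx, by simpa using hz⟩, fun g hg => by
          simpa [hsum] using hxg g hg⟩
      · rintro ⟨z, hz, hg⟩
        exact ⟨_, hz.2, (hiff₁ _ ((hiff p hp).1 _ hz.2)).2.2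
          ⟨z 0, hz.1, fun g hg' => by simpa [hsum] using hg g hg'⟩⟩

theorem norm_circleIntegral_coeff_le {F : ℂ → ℂ} {ρ M : ℝ} (hρ : 0 < ρ)
    (hF : DifferentiableOn ℂ F (closedBall 0 ρ)) (hM : ∀ x ∈ sphere (0 : ℂ) ρ, ‖F x‖ ≤ M) {s : ℕ}
    (hc : ∀ j < s, ∮ x in C(0, ρ), (x ^ (j + 1))⁻¹ * F x = 0) {τ : ℂ} (hτ0 : τ ≠ 0)
    (hτ : ‖τ‖ ≤ ρ / 2) (hFτ : F τ = 0) :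
    ‖∮ x in C(0, ρ), (x ^ (s + 1))⁻¹ * F x‖ ≤
      ‖τ‖ * (2 * Real.pi * ρ * ((ρ ^ (s + 1))⁻¹ * (2 / ρ) * M)) := by
  have hx0 : ∀ x ∈ sphere (0 : ℂ) ρ, x ≠ 0 := fun x hx => ne_of_mem_sphere hx hρ.ne'
  have hge : ∀ x ∈ sphere (0 : ℂ) ρ, ρ / 2 ≤ ‖x - τ‖ := fun x hx => by
    have := norm_sub_norm_le x τ
    rw [mem_sphere_zero_iff_norm.1 hx] at this
    linarith
  have hxτ : ∀ x ∈ sphere (0 : ℂ) ρ, x - τ ≠ 0 := fun x hx h => by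
    have := hge x hx
    rw [h, norm_zero] at this
    linarith
  have hFc : ContinuousOn F (sphere 0 ρ) := hF.continuousOn.mono sphere_subset_closedBall
  have hpow : ∀ m : ℕ, ContinuousOn (fun x : ℂ => (x ^ m)⁻¹) (sphere 0 ρ) := fun m =>
    (continuousOn_pow m).inv₀ fun x hx => pow_ne_zero _ (hx0 x hx)
  have hsub : ContinuousOn (fun x : ℂ => (x - τ)⁻¹) (sphere 0 ρ) :=
    (continuousOn_id.sub continuousOn_const).inv₀ hxτ
  have hrec : ∀ m : ℕ, ∮ x in C(0, ρ), (x ^ m)⁻¹ * (x - τ)⁻¹ * F x =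
      (∮ x in C(0, ρ), (x ^ (m + 1))⁻¹ * F x) +
        τ * ∮ x in C(0, ρ), (x ^ (m + 1))⁻¹ * (x - τ)⁻¹ * F x := fun m => by
    have h1 : CircleIntegrable (fun x => (x ^ (m + 1))⁻¹ * F x) 0 ρ :=
      ContinuousOn.circleIntegrable hρ.le ((hpow _).mul hFc)
    have h2 : CircleIntegrable (fun x => τ * ((x ^ (m + 1))⁻¹ * (x - τ)⁻¹ * F x)) 0 ρ :=
      ContinuousOn.circleIntegrable hρ.le (continuousOn_const.mul (((hpow _).mul hsub).mul hFc))
    rw [← circleIntegral.integral_const_mul, ← circleIntegral.integral_add h1 h2]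
    refine circleIntegral.integral_congr hρ.le fun x hx => ?_
    have h1 := hx0 x hx
    have h2 := hxτ x hx
    field_simp
    ring
  have hzero : ∀ m ≤ s, ∮ x in C(0, ρ), (x ^ m)⁻¹ * (x - τ)⁻¹ * F x = 0 := by
    intro m
    induction m with
    | zero =>
      intro _
      have := hF.circleIntegral_sub_inv_smul (w := τ) (mem_ball_zero_iff.2 (by linarith))
      simpa [hFτ] using this
    | succ m ih =>
      intro hm
      have := hrec m
      rw [ih (by omega), hc m (by omega), zero_add, eq_comm, mul_eq_zero] at this
      exact this.resolve_left hτ0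
  have h1 := hrec s
  rw [hzero s le_rfl, eq_comm, add_eq_zero_iff_eq_neg] at h1
  rw [h1, norm_neg, norm_mul]
  refine mul_le_mul_of_nonneg_left
    (circleIntegral.norm_integral_le_of_norm_le_const hρ.le fun x hx => ?_) (norm_nonneg τ)
  rw [norm_mul, norm_mul, norm_inv, norm_inv, norm_pow, mem_sphere_zero_iff_norm.1 hx]
  have h2 : ‖x - τ‖⁻¹ ≤ 2 / ρ := by
    rw [show 2 / ρ = (ρ / 2)⁻¹ by rw [inv_div]]
    exact inv_anti₀ (by positivity) (hge x hx)
  have := hM x hx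
  gcongr

theorem eq_zero_of_circleIntegral_coeff_eq_zero {F : ℂ → ℂ} {ρ : ℝ} (hρ : 0 < ρ)
    (hF : DifferentiableOn ℂ F (closedBall 0 ρ))
    (hc : ∀ j : ℕ, ∮ x in C(0, ρ), (x ^ (j + 1))⁻¹ * F x = 0) {τ : ℂ} (hτ : ‖τ‖ < ρ) :
    F τ = 0 := by
  have hs := hasSum_two_pi_I_cauchyPowerSeries_integral (f := F) (c := 0) (R := ρ) (w := τ)
    (ContinuousOn.circleIntegrable hρ.le (hF.continuousOn.mono sphere_subset_closedBall)) hτ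
  have h0 : (fun n : ℕ => ∮ z in C(0, ρ), (τ / (z - 0)) ^ n • (z - 0)⁻¹ • F z) = fun _ => 0 := by
    funext n
    have h1 : ∮ z in C(0, ρ), (τ / (z - 0)) ^ n • (z - 0)⁻¹ • F z =
        τ ^ n * ∮ z in C(0, ρ), (z ^ (n + 1))⁻¹ * F z := by
      rw [← circleIntegral.integral_const_mul]
      refine circleIntegral.integral_congr hρ.le fun z _ => ?_
      simp only [sub_zero, smul_eq_mul, div_pow, pow_succ, mul_inv]
      ring
    rw [h1, hc n, mul_zero]
  rw [h0] at hs
  have h1 := hF.circleIntegral_sub_inv_smul (w := τ) (mem_ball_zero_iff.2 hτ)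
  have h2 := hs.unique hasSum_zero
  rw [zero_add, h1] at h2
  simpa [Real.pi_ne_zero] using h2

theorem not_ball_subset_image_submodule {V : Type*} [NormedAddCommGroup V] [NormedSpace ℝ V]
    [FiniteDimensional ℝ V] {S : Submodule ℝ V} (hS : S ≠ ⊤) {φ : V → V} (hφ : Differentiable ℝ φ)
    (a : V) {ε : ℝ} (hε : 0 < ε) : ¬ ball a ε ⊆ φ '' S := by
  borelize V
  intro h
  have h0 := MeasureTheory.addHaar_image_eq_zero_of_differentiableOn_of_addHaar_eq_zero
    MeasureTheory.Measure.addHaar (hφ.differentiableOn (s := S))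
    (MeasureTheory.Measure.addHaar_submodule _ S hS)
  exact (measure_ball_pos MeasureTheory.Measure.addHaar a hε).ne'
    (MeasureTheory.measure_mono_null h h0)

theorem LineHolOn.of_differentiable {F : E → ℂ} (hF : Differentiable ℂ F) {U : Set E} :
    LineHolOn F U :=
  ⟨hF.continuous.continuousOn, fun _ _ => (hF.comp (by fun_prop)).differentiableOn⟩

variable {V : Type*} [NormedAddCommGroup V] [NormedSpace ℂ V] [FiniteDimensional ℂ V]

/-- If `Q p ≠ 0`, then for a suitable direction `y` and every small nonzero `σ`, the function `Q`
has no zeros `(v, τ • p.2)` close to `(σ • y, 0)` with `τ ≠ 0`. -/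
theorem LineHolOn.exists_direction {Q : V × V → ℂ} {ε : ℝ}
    (hQ : LineHolOn Q (ball (0 : V × V) ε)) {S : Submodule ℂ V} (hS : S ≠ ⊤) {p : V × V}
    (hp : p ∈ ball (0 : V × V) ε) (hpQ : Q p ≠ 0) :
    ∃ y ∉ S, ∀ᶠ σ : ℂ in 𝓝[≠] 0, ∀ᶠ q : V × ℂ in 𝓝 (σ • y, 0),
      q.2 ≠ 0 → Q (q.1, q.2 • p.2) ≠ 0 := by
  obtain ⟨p₁, u⟩ := p
  rw [mem_ball_zero_iff, Prod.norm_mk, max_lt_iff] at hp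
  obtain ⟨hp₁, hu⟩ := hp
  have hε : 0 < ε := (norm_nonneg _).trans_lt hp₁
  obtain ⟨ρ, hρ1, hρu⟩ : ∃ ρ : ℝ, 1 < ρ ∧ ρ * ‖u‖ < ε := by
    have hpos : 0 < ε + ‖u‖ := by positivity
    refine ⟨2 * ε / (ε + ‖u‖), (one_lt_div hpos).2 (by linarith), ?_⟩
    rw [div_mul_eq_mul_div, div_lt_iff₀ hpos]
    nlinarith
  have hρ : 0 < ρ := one_pos.trans hρ1
  set W : Set (V × V) := ball 0 ε ×ˢ ball 0 (ε - ρ * ‖u‖) with hW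
  have hWo : IsOpen W := isOpen_ball.prod isOpen_ball
  have hWQ : ∀ q ∈ W, ∀ x ∈ closedBall (0 : ℂ) ρ,
      q + x • ((0, u) : V × V) ∈ ball (0 : V × V) ε := by
    rintro ⟨v, w⟩ ⟨hv, hw⟩ x hx
    rw [mem_ball_zero_iff] at hv hw
    rw [mem_closedBall_zero_iff] at hx
    rw [mem_ball_zero_iff, Prod.smul_mk, Prod.mk_add_mk, Prod.norm_mk, max_lt_iff]
    refine ⟨by simpa using hv, ?_⟩
    calc ‖w + x • u‖ ≤ ‖w‖ + ‖x‖ * ‖u‖ := (norm_add_le _ _).trans_eq (by rw [norm_smul])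
      _ ≤ ‖w‖ + ρ * ‖u‖ := by gcongr
      _ < ε := by simp only at hw; linarith
  have hmemW : ∀ v : V, ‖v‖ < ε → ((v, 0) : V × V) ∈ W := fun v hv =>
    ⟨mem_ball_zero_iff.2 hv, mem_ball_self (by linarith)⟩
  set C : ℕ → V × V → ℂ :=
    fun j q => ∮ x in C(0, ρ), (x ^ (j + 1))⁻¹ * Q (q + x • ((0, u) : V × V)) with hCdef
  have hC : ∀ j, LineHolOn (C j) W := fun j =>
    hQ.circleIntegral hWo hρ.le ((continuousOn_pow _).inv₀ fun x hx =>
      pow_ne_zero _ (ne_of_mem_sphere hx hρ.ne')) fun q hq x hx =>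
        hWQ q hq x (sphere_subset_closedBall hx)
  have hFd : ∀ q ∈ W, DifferentiableOn ℂ (fun x : ℂ => Q (q + x • ((0, u) : V × V)))
      (closedBall 0 ρ) := fun q hq => (hQ.2 q (0, u)).mono fun x hx => hWQ q hq x hx
  have hex : ∃ j, ∃ v : V, ‖v‖ < ε ∧ C j (v, 0) ≠ 0 := by
    by_contra! hall
    refine hpQ ?_
    have := eq_zero_of_circleIntegral_coeff_eq_zero hρ (hFd _ (hmemW p₁ hp₁))
      (fun j => hall j p₁ hp₁) (τ := 1) (by simpa using hρ1)
    simpa using this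
  classical
  set s := Nat.find hex with hs
  obtain ⟨v₀, hv₀, hv₀C⟩ := Nat.find_spec hex
  have hlt : ∀ j < s, ∀ v : V, ‖v‖ < ε → C j (v, 0) = 0 := fun j hj v hv => by
    by_contra hne
    exact Nat.find_min hex hj ⟨v, hv, hne⟩
  have hCc : ContinuousOn (fun v : V => C s (v, 0)) (ball 0 ε) :=
    (hC s).1.comp (by fun_prop) fun v hv => hmemW v (mem_ball_zero_iff.1 hv)
  obtain ⟨y, hyS, hyε, hyC⟩ : ∃ y ∉ S, ‖y‖ < ε ∧ C s (y, 0) ≠ 0 := by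
    by_contra! hall
    refine hS (Submodule.eq_top_of_nonempty_interior' S ⟨v₀, mem_interior_iff_mem_nhds.2 ?_⟩)
    filter_upwards [isOpen_ball.mem_nhds (mem_ball_zero_iff.2 hv₀),
      (hCc.continuousAt (isOpen_ball.mem_nhds (mem_ball_zero_iff.2 hv₀))).eventually_ne hv₀C]
      with v hv hvC
    by_contra hvS
    exact hvC (hall v hvS (mem_ball_zero_iff.1 hv))
  refine ⟨y, hyS, ?_⟩
  have hy : 0 < ‖y‖ := norm_pos_iff.2 fun h => hyS (h ▸ S.zero_mem)
  have hsmall : ∀ σ ∈ ball (0 : ℂ) (ε / ‖y‖), ‖σ • y‖ < ε := fun σ hσ => by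
    rw [mem_ball_zero_iff, lt_div_iff₀ hy] at hσ
    rwa [norm_smul]
  have hD : AnalyticOnNhd ℂ (fun σ : ℂ => C s (σ • y, 0)) (ball 0 (ε / ‖y‖)) := by
    refine DifferentiableOn.analyticOnNhd ?_ isOpen_ball
    have h1 : DifferentiableOn ℂ (fun σ : ℂ => C s (0 + σ • (y, 0)))
        (ball 0 (ε / ‖y‖)) := ((hC s).2 0 (y, 0)).mono fun σ hσ => by
      simpa using hmemW _ (hsmall σ hσ)
    simpa using h1
  have hev : ∀ᶠ σ : ℂ in 𝓝[≠] 0, C s (σ • y, 0) ≠ 0 := by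
    have h0 : (0 : ℂ) ∈ ball (0 : ℂ) (ε / ‖y‖) := mem_ball_self (by positivity)
    refine (hD 0 h0).eventually_eq_zero_or_eventually_ne_zero.resolve_left fun hz => hyC ?_
    have h1 : (1 : ℂ) ∈ ball (0 : ℂ) (ε / ‖y‖) := by
      rw [mem_ball_zero_iff, lt_div_iff₀ hy]; simpa using hyε
    simpa using hD.eqOn_zero_of_preconnected_of_eventuallyEq_zero
      (convex_ball (0 : ℂ) _).isPreconnected h0 hz h1
  filter_upwards [hev, mem_nhdsWithin_of_mem_nhds (ball_mem_nhds (0 : ℂ)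
    (show 0 < ε / ‖y‖ by positivity))] with σ hσ hσb
  have hv₁ : σ • y ∈ ball (0 : V) ε := mem_ball_zero_iff.2 (hsmall σ hσb)
  set c := ‖C s (σ • y, 0)‖ with hc
  have hcpos : 0 < c := norm_pos_iff.2 hσ
  have hnear : ∀ᶠ v in 𝓝 (σ • y), c / 2 < ‖C s (v, 0)‖ :=
    (hCc.continuousAt (isOpen_ball.mem_nhds hv₁)).norm.eventually
      (lt_mem_nhds (half_lt_self hcpos))
  obtain ⟨η, hη, hηsub⟩ := Metric.nhds_basis_closedBall.mem_iff.1
    (inter_mem (isOpen_ball.mem_nhds hv₁) hnear)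
  have : ProperSpace V := FiniteDimensional.proper ℂ V
  obtain ⟨M, hM⟩ := ((isCompact_closedBall (σ • y) η).prod
    (isCompact_closedBall (0 : ℂ) ρ)).exists_bound_of_continuousOn
    (f := fun q : V × ℂ => Q ((q.1, 0) + q.2 • ((0, u) : V × V)))
    (hQ.1.comp (by fun_prop) fun q hq =>
      hWQ _ (hmemW _ (mem_ball_zero_iff.1 (hηsub hq.1).1)) _ hq.2)
  set K := 2 * Real.pi * ρ * ((ρ ^ (s + 1))⁻¹ * (2 / ρ) * M) with hK
  have hτ : ∀ᶠ τ : ℂ in 𝓝 0, ‖τ‖ < ρ / 2 ∧ ‖τ‖ * K < c / 2 := by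
    refine Eventually.and ?_ ?_
    · exact (continuous_norm.tendsto' (0 : ℂ) 0 norm_zero).eventually
        (gt_mem_nhds (by positivity))
    · exact ((continuous_norm.mul continuous_const).tendsto' (0 : ℂ) 0 (by simp)).eventually
        (gt_mem_nhds (by positivity))
  filter_upwards [prod_mem_nhds (closedBall_mem_nhds (σ • y) hη) hτ] with q hq hq0 hQ0
  obtain ⟨hq₁, hq₂, hq₃⟩ := hq
  have hqε : ‖q.1‖ < ε := mem_ball_zero_iff.1 (hηsub hq₁).1
  have hle := norm_circleIntegral_coeff_le hρ (hFd _ (hmemW q.1 hqε))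
    (fun x hx => hM (q.1, x) ⟨hq₁, sphere_subset_closedBall hx⟩)
    (fun j hj => hlt j hj q.1 hqε) hq0 hq₂.le (by simpa using hQ0)
  exact absurd (hle.trans_lt hq₃) (not_lt.2 (hηsub hq₁).2.le)

theorem IsOpenMap.exists_isolated_cons {φ : V → V} (hφo : IsOpenMap φ) (hφ : Differentiable ℂ φ)
    {n : ℕ} (hn : n < Module.finrank ℂ V) {e : Fin n → V} (he : LinearIndependent ℂ e)
    {r₀ : ℝ} (hr₀ : 0 < r₀)
    (hiso : ∀ z : Fin n → ℂ, ‖z‖ < r₀ → φ (∑ i, z i • e i) = φ 0 → z = 0) :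
    ∃ y : V, LinearIndependent ℂ (Fin.cons y e : Fin (n + 1) → V) ∧ ∃ r > 0,
      ∀ z : Fin (n + 1) → ℂ, ‖z‖ < r →
        φ (∑ i, z i • (Fin.cons y e : Fin (n + 1) → V) i) = φ 0 → z = 0 := by
  let 𝒢 : Set (V × V → ℂ) :=
    range fun (ℓ : StrongDual ℂ V) (p : V × V) => ℓ (φ p.1 - (φ 0 + p.2))
  have h𝒢 : ∀ g ∈ 𝒢, LineHolOn g univ := by
    rintro _ ⟨ℓ, rfl⟩
    exact LineHolOn.of_differentiable (by fun_prop)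
  have h𝒢0 : ∀ p : V × V, (∀ g ∈ 𝒢, g p = 0) ↔ φ p.1 = φ 0 + p.2 := fun p => by
    rw [← sub_eq_zero (b := φ 0 + p.2)]
    constructor
    · intro h
      exact SeparatingDual.eq_zero_of_forall_dual_eq_zero (R := ℂ) fun ℓ => h _ ⟨ℓ, rfl⟩
    · rintro h _ ⟨ℓ, rfl⟩
      simp only [h, map_zero]
  have hsum : ∀ z : Fin n → ℂ, ∑ i, z i • ((e i, 0) : V × V) = (∑ i, z i • e i, 0) := fun z => by
    ext <;> simp [Prod.fst_sum, Prod.snd_sum]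
  obtain ⟨Z, hZ, hZr, W, hW, h0W, 𝒬, h𝒬, hiff⟩ :=
    LineHolOn.exists_projection (e := fun i => ((e i, 0) : V × V)) isOpen_univ (mem_univ _) h𝒢 hr₀
      fun z hz hg => hiso z hz (by
        have := (h𝒢0 _).1 hg
        rw [hsum] at this
        simpa using this)
  have hiff' : ∀ p ∈ W, (∀ Q ∈ 𝒬, Q p = 0) ↔ ∃ z ∈ Z, φ (p.1 + ∑ i, z i • e i) = φ 0 + p.2 :=
    fun p hp => by
      rw [(hiff p hp).2]
      simp only [h𝒢0, hsum, Prod.fst_add, Prod.snd_add, add_zero]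
  set S := Submodule.span ℂ (range e) with hSdef
  have hS : S ≠ ⊤ := fun h => by
    have h1 := finrank_span_eq_card he
    rw [← hSdef, h, finrank_top, Fintype.card_fin] at h1
    omega
  have hmemS : ∀ z : Fin n → ℂ, ∑ i, z i • e i ∈ S := fun z =>
    Submodule.sum_mem _ fun i _ => S.smul_mem _ (Submodule.subset_span ⟨i, rfl⟩)
  obtain ⟨ε, hε, hεW⟩ := Metric.isOpen_iff.1 hW 0 h0W
  obtain ⟨p, hp, Q, hQ, hpQ⟩ : ∃ p ∈ ball (0 : V × V) ε, ∃ Q ∈ 𝒬, Q p ≠ 0 := by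
    by_contra! hall
    have hS' : S.restrictScalars ℝ ≠ ⊤ := by simpa using hS
    refine not_ball_subset_image_submodule hS' (hφ.restrictScalars ℝ) (φ 0) hε fun w hw => ?_
    have hpw : ((0, w - φ 0) : V × V) ∈ ball (0 : V × V) ε := by
      rw [mem_ball_zero_iff, Prod.norm_mk, norm_zero, max_eq_right (norm_nonneg _)]
      exact mem_ball_iff_norm.1 hw
    obtain ⟨z, -, hz⟩ := (hiff' _ (hεW hpw)).1 (hall _ hpw)
    exact ⟨∑ i, z i • e i, hmemS z, by simpa using hz⟩
  obtain ⟨y, hyS, hy⟩ := ((h𝒬 Q hQ).mono hεW).exists_direction hS hp hpQ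
  refine ⟨y, linearIndependent_finCons.2 ⟨he, hyS⟩, ?_⟩
  by_contra! hnot
  obtain ⟨r₁, hr₁, hr₁y⟩ := Metric.mem_nhdsWithin_iff.1 hy
  obtain ⟨r₂, hr₂, hr₂Z⟩ := Metric.mem_nhds_iff.1 hZ
  obtain ⟨r₃, hr₃, hr₃W⟩ := Metric.mem_nhds_iff.1
    (((by fun_prop : Continuous fun σ : ℂ => ((σ • y, 0) : V × V)).tendsto' 0 0
      (by simp)).eventually (hW.mem_nhds h0W))
  obtain ⟨z, hz, hφz, hz0⟩ := hnot (min (min r₀ r₁) (min r₂ r₃)) (by positivity)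
  simp only [lt_min_iff] at hz
  obtain ⟨⟨hzr₀, hzr₁⟩, hzr₂, hzr₃⟩ := hz
  rw [Fin.sum_univ_succ] at hφz
  simp only [Fin.cons_zero, Fin.cons_succ] at hφz
  have htail : ‖fun i : Fin n => z i.succ‖ ≤ ‖z‖ :=
    (pi_norm_le_iff_of_nonneg (norm_nonneg z)).2 fun i => norm_le_pi_norm z i.succ
  have hσ0 : z 0 ≠ 0 := fun h => hz0 <| by
    rw [h, zero_smul, zero_add] at hφz
    have := hiso _ (htail.trans_lt hzr₀) hφz
    funext i
    exact Fin.cases h (fun i => congrFun this i) i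
  have hσ := (norm_le_pi_norm z 0)
  have hfar := hr₁y ⟨mem_ball_zero_iff.2 (hσ.trans_lt hzr₁), hσ0⟩
  set x := ∑ i : Fin n, z i.succ • e i
  have hin : ∀ᶠ q : V × ℂ in 𝓝 (z 0 • y, 0), (q.1, q.2 • p.2) ∈ W :=
    ((by fun_prop : Continuous fun q : V × ℂ => (q.1, q.2 • p.2)).tendsto' (z 0 • y, 0)
      (z 0 • y, 0) (by simp)).eventually
      (hW.mem_nhds (hr₃W (mem_ball_zero_iff.2 (hσ.trans_lt hzr₃))))
  obtain ⟨N, hN, T, hT, hNT⟩ := mem_nhds_prod_iff.1 (hfar.and hin)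
  have himage : φ '' ((fun w => w - x) ⁻¹' N) ∈ 𝓝 (φ 0) := by
    rw [← hφz]
    refine hφo.image_mem_nhds ((by fun_prop : Continuous fun w => w - x).continuousAt ?_)
    simpa using hN
  have hτ : ∀ᶠ τ : ℂ in 𝓝 0, φ 0 + τ • p.2 ∈ φ '' ((fun w => w - x) ⁻¹' N) :=
    ((by fun_prop : Continuous fun τ : ℂ => φ 0 + τ • p.2).tendsto' 0 (φ 0) (by simp)).eventually
      himage
  obtain ⟨τ, ⟨⟨w, hwN, hw⟩, hτT⟩, hτ0⟩ :=
    (((hτ.and hT).filter_mono nhdsWithin_le_nhds).and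
      (self_mem_nhdsWithin (a := (0 : ℂ)) (s := {0}ᶜ))).exists
  obtain ⟨hne, hmem⟩ := hNT (mk_mem_prod hwN hτT)
  refine hne hτ0 ((hiff' _ hmem).2 ⟨_, hr₂Z (mem_ball_zero_iff.2 (htail.trans_lt hzr₂)), ?_⟩ Q hQ)
  simpa [x] using hw

/-- A continuous open map that is holomorphic between spaces of equal dimension has isolated
fibres. -/
theorem IsOpenMap.exists_forall_ne_of_differentiable {φ : V → V} (hφo : IsOpenMap φ)
    (hφ : Differentiable ℂ φ) : ∃ ε > 0, ∀ z, z ≠ 0 → ‖z‖ ≤ ε → φ z ≠ φ 0 := by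
  have key : ∀ n ≤ Module.finrank ℂ V, ∃ e : Fin n → V, LinearIndependent ℂ e ∧ ∃ r > 0,
      ∀ z : Fin n → ℂ, ‖z‖ < r → φ (∑ i, z i • e i) = φ 0 → z = 0 := by
    intro n
    induction n with
    | zero =>
      exact fun _ => ⟨Fin.elim0, linearIndependent_empty_type, 1, one_pos,
        fun z _ _ => Subsingleton.elim _ _⟩
    | succ n ih =>
      intro hn
      obtain ⟨e, he, r, hr, hiso⟩ := ih (by omega)
      obtain ⟨y, hy⟩ := hφo.exists_isolated_cons hφ hn he hr hiso
      exact ⟨_, hy⟩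
  obtain ⟨e, he, r, hr, hiso⟩ := key _ le_rfl
  let b := basisOfLinearIndependentOfCardEqFinrank' e he (by simp)
  have hcont : Continuous fun z : V => b.equivFun z :=
    LinearMap.continuous_of_finiteDimensional b.equivFun.toLinearMap
  obtain ⟨ε, hε, hεr⟩ := Metric.nhds_basis_closedBall.mem_iff.1
    ((hcont.tendsto' 0 0 (by simp)).eventually (ball_mem_nhds (0 : Fin _ → ℂ) hr))
  refine ⟨ε, hε, fun z hz hzε h => hz ?_⟩
  refine b.equivFun.map_eq_zero_iff.1 (hiso _ (mem_ball_zero_iff.1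
    (hεr (mem_closedBall_zero_iff.2 hzε))) ?_)
  rw [← h]
  congr 1
  simpa [b] using b.sum_equivFun z

end Isolation

/-- A compact completely invariant set `J ⊆ ℂᵏ` of a holomorphic
endomorphism `f`, with a repelling fixed point `a ∈ J` admitting a Poincaré map
`φ` (open holomorphic, `φ(0) = a`, `f ∘ φ = φ ∘ Λ`, `Λ` a dilating automorphism),
contains no positive-dimensional complex submanifold through `a` — here expressed
by a holomorphic disc through `a` with nonzero derivative whose image lies in `J`.
(Otherwise `J` would contain a nonconstant entire curve, contradicting its
compactness by Liouville's theorem.) -/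
theorem stmt_5 (k : ℕ) (J : Set (Fin k → ℂ)) (hJc : IsCompact J)
    (f : (Fin k → ℂ) → (Fin k → ℂ)) (hf : Differentiable ℂ f)
    (hJinv : f '' J = J)
    (a : Fin k → ℂ) (haJ : a ∈ J) (hfix : f a = a)
    (φ Λ Λinv : (Fin k → ℂ) → (Fin k → ℂ))
    (hφd : Differentiable ℂ φ) (hφopen : IsOpenMap φ) (hφ0 : φ 0 = a)
    (hΛd : Differentiable ℂ Λ)
    (hconj : ∀ z, f (φ z) = φ (Λ z))
    (hΛinv : ∀ z, Λ (Λinv z) = z ∧ Λinv (Λ z) = z)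
    (hdil : ∀ z, Tendsto (fun m => Λinv^[m] z) atTop (nhds (0 : Fin k → ℂ))) :
    ¬ ∃ ι : ℂ → (Fin k → ℂ),
        DifferentiableOn ℂ ι (Metric.ball 0 1) ∧ ι 0 = a ∧
        fderivWithin ℂ ι (Metric.ball 0 1) 0 ≠ 0 ∧
        ι '' Metric.ball 0 1 ⊆ J := by
  rintro ⟨ι, hι, hι0, hι', hιJ⟩
  have hb : ball (0 : ℂ) 1 ∈ 𝓝 (0 : ℂ) := ball_mem_nhds _ one_pos
  have hΛ0 : Λ 0 = 0 := map_zero_of_tendsto hΛd.continuous (fun z => (hΛinv z).1) (hdil 0)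
  have hconjm : ∀ m z, f^[m] (φ z) = φ (Λ^[m] z) := fun m z =>
    ((show Function.Semiconj φ Λ f from fun z => (hconj z).symm).iterate_right m z).symm
  set A := fderiv ℂ f a
  set v := deriv ι 0 with hv
  have hv0 : v ≠ 0 := by
    rw [fderivWithin_of_mem_nhds hb] at hι'
    rw [hv, ← norm_ne_zero_iff, norm_deriv_eq_norm_fderiv, norm_ne_zero_iff]
    exact hι'
  obtain ⟨R, hR⟩ : ∃ R, ∀ w ∈ J, ‖w - a‖ ≤ R := by
    obtain ⟨R, hR⟩ := hJc.isBounded.subset_closedBall a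
    exact ⟨R, fun w hw => by simpa [dist_eq_norm] using hR hw⟩
  have hR0 : 0 ≤ R := by simpa using hR a haJ
  have hJm : ∀ m, MapsTo f^[m] J J := fun m =>
    MapsTo.iterate (fun x hx => hJinv ▸ mem_image_of_mem f hx) m
  set h : ℕ → ℂ → (Fin k → ℂ) := fun m t => f^[m] (ι t) with hh
  have hhd : ∀ m, DifferentiableOn ℂ (h m) (ball 0 1) := fun m =>
    (hf.iterate m).comp_differentiableOn hι
  have hh0 : ∀ m, h m 0 = a := fun m => by
    simp only [hh, hι0]; exact Function.iterate_fixed hfix m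
  have hhR : ∀ m, ∀ t ∈ ball (0 : ℂ) 1, ‖h m t - h m 0‖ ≤ R := fun m t ht => by
    rw [hh0]; exact hR _ (hJm m (hιJ (mem_image_of_mem _ ht)))
  have hh' : ∀ m, deriv (h m) 0 = (A ^ m) v := fun m => by
    have h1 : HasFDerivAt f^[m] (A ^ m) (ι 0) := by
      rw [hι0]; exact (hf a).hasFDerivAt.iterate hfix m
    exact (h1.comp_hasDerivAt 0 (hι.differentiableAt hb).hasDerivAt).deriv
  have hhm : ∀ m, MapsTo (h m) (ball 0 1) (closedBall (h m 0) R) := fun m t ht => by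
    simpa [dist_eq_norm] using hhR m t ht
  obtain ⟨c, hc, hcA⟩ := exists_le_norm_pow_apply A
    (eq_zero_of_tendsto_pow_fderiv hf hfix hφd hφopen hφ0 hΛd hconj hΛinv hdil) hv0
    (M := R) fun m => by
      rw [← hh' m]
      simpa using Complex.norm_deriv_le_div_of_mapsTo_ball (hhd m) (hhm m) one_pos
  obtain ⟨ε, hε, hεφ⟩ := hφopen.exists_forall_ne_of_differentiable hφd
  obtain ⟨δ, hδ, hδφ⟩ : ∃ δ > 0, ∀ z ∈ sphere (0 : Fin k → ℂ) ε, δ ≤ ‖φ z - a‖ := by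
    have hcont : ContinuousOn (fun z => ‖φ z - a‖) (sphere (0 : Fin k → ℂ) ε) :=
      (hφd.continuous.sub continuous_const).norm.continuousOn
    refine (isCompact_sphere (0 : Fin k → ℂ) ε).exists_forall_le' hcont (a := 0) fun z hz => ?_
    rw [norm_pos_iff, sub_ne_zero, ← hφ0]
    rw [mem_sphere_zero_iff_norm] at hz
    exact hεφ z (by rw [← norm_pos_iff, hz]; exact hε) hz.le
  obtain ⟨s, hs0, hs1, hsδ, hsc⟩ : ∃ s : ℝ, 0 < s ∧ s < 1 ∧ R * s < δ ∧ 2 * R * s ≤ c / 2 := by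
    have h1 : Tendsto (fun s : ℝ => R * s) (𝓝[>] 0) (𝓝 0) := by
      have : Continuous fun s : ℝ => R * s := by fun_prop
      simpa using (this.tendsto 0).mono_left nhdsWithin_le_nhds
    have h2 : Tendsto (fun s : ℝ => s) (𝓝[>] 0) (𝓝 0) := nhdsWithin_le_nhds
    have := (((eventually_mem_nhdsWithin (a := (0 : ℝ)) (s := Ioi 0)).and
      (h2.eventually_lt_const one_pos)).and (h1.eventually_lt_const hδ)).and
      (h1.eventually_lt_const (show 0 < c / 4 by positivity))
    obtain ⟨s, ⟨⟨h3, h4⟩, h5⟩, h6⟩ := this.exists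
    exact ⟨s, h3, h4, h5, by linarith⟩
  have hsub : closedBall (0 : ℂ) s ⊆ ball 0 1 := closedBall_subset_ball hs1
  have hhδ : ∀ m, ∀ t ∈ closedBall (0 : ℂ) s, ‖h m t - a‖ < δ := fun m t ht => by
    have h1 := Complex.dist_le_div_mul_dist_of_mapsTo_ball (hhd m) (hhm m) (hsub ht)
    rw [div_one, dist_eq_norm, hh0] at h1
    exact h1.trans_lt ((mul_le_mul_of_nonneg_left ht hR0).trans_lt hsδ)
  have hs : ((s : ℝ) : ℂ) ∈ closedBall (0 : ℂ) s := by simp [abs_of_pos hs0]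
  have hhs : ∀ m, s * c / 2 ≤ ‖h m s - a‖ := fun m => by
    have h1 := norm_sub_sub_smul_deriv_le (hhd m) (hhR m) (hsub hs)
    have h2 := norm_sub_norm_le ((s : ℂ) • deriv (h m) 0)
      ((s : ℂ) • deriv (h m) 0 - (h m s - h m 0))
    rw [sub_sub_cancel, norm_sub_rev ((s : ℂ) • deriv (h m) 0), norm_smul, hh', hh0,
      Complex.norm_real, Real.norm_of_nonneg hs0.le] at h2
    rw [hh', hh0, Complex.norm_real, Real.norm_of_nonneg hs0.le] at h1
    have h3 := mul_le_mul_of_nonneg_left (hcA m) hs0.le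
    nlinarith
  set C := ι '' closedBall 0 s with hC
  have hCc : IsCompact C :=
    (isCompact_closedBall 0 s).image_of_continuousOn (hι.continuousOn.mono hsub)
  have haC : a ∈ C := ⟨0, mem_closedBall_self hs0.le, hι0⟩
  have hCδ : ∀ m, ∀ w ∈ C, ‖f^[m] w - a‖ < δ := by
    rintro m _ ⟨t, ht, rfl⟩; exact hhδ m t ht
  obtain ⟨S, hSB, hS, h0S, hSC, z, hzS, hz⟩ := exists_isPreconnected_lift hφd.continuous hφopen
    (isCompact_closedBall (0 : Fin k → ℂ) ε) hCc.isClosed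
    ((convex_closedBall (0 : ℂ) s).isPreconnected.image _ (hι.continuousOn.mono hsub))
    (fun z hz hzC => by
      rw [interior_closedBall _ hε.ne']
      refine mem_ball_zero_iff.2 (lt_of_le_of_ne (mem_closedBall_zero_iff.1 hz) fun h1 => ?_)
      exact (hδφ z (mem_sphere_zero_iff_norm.2 h1)).not_gt (hCδ 0 _ hzC))
    (mem_closedBall_self hε.le) (hφ0 ▸ haC) (mem_image_of_mem ι hs)
  have horbit : ∀ j, Λ^[j] z ∈ closedBall 0 ε := fun j => by
    refine (hS.image _ (hΛd.continuous.iterate j).continuousOn).subset_closedBall_of_disjoint_sphere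
      ⟨0, h0S, Function.iterate_fixed hΛ0 j⟩ hε ?_ (mem_image_of_mem _ hzS)
    rintro _ ⟨x, hx, rfl⟩ h1
    refine (hδφ _ (mem_sphere_zero_iff_norm.2 h1)).not_gt ?_
    rw [← hconjm]
    exact hCδ j _ (hSC (mem_image_of_mem _ hx))
  refine false_of_orbit_mem_compact hΛd.continuous (fun z => (hΛinv z).2) hdil
    (isCompact_closedBall 0 ε) (F := {z | s * c / 2 ≤ ‖φ z - a‖})
    (isClosed_le continuous_const (hφd.continuous.sub continuous_const).norm) ?_ horbit fun j => ?_
  · simp only [mem_ofPred_eq, hφ0, sub_self, norm_zero, not_le]; positivity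
  · rw [mem_ofPred_eq, ← hconjm, hz]; exact hhs j
end
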